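/- arXiv:0812.5003 — 4 statements merged into one kernel-verified Lean document; each statement's English description precedes it below -/
import Mathlib

section
/- Let T be the centerless topological N=2 superconformal algebra. If r ∈ T⊗T satisfies x·r = 0 for all x ∈ T (adjoint diagonal action), then r = 0. -/
/-!
Common setup: the centerless topological N=2 superconformal algebra `T`,
modelled as the free ℂ-module on basis `{L_n, H_n, G_n, Q_n : n ∈ ℤ}`
(encoded as finitely supported functions `(N2Gen × ℤ) →₀ ℂ`), together with
its super-bracket, the tensor square `TT` and cube `TTT` (modelled as
finitely supported functions on pairs/triples of indices), the adjoint
diagonal actions, the super-twist and super-cyclic maps, parity and degree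
predicates, (inner) super-derivations, the coboundary map `Δ_r = innerDer r`,
the classical Yang–Baxter expression `c(r)`, and the Lie super-bialgebra
predicate.
-/

noncomputable section

/-- The four families of generators of the topological N=2 superconformal algebra. -/
inductive N2Gen : Type
  | L | H | G | Q
  deriving DecidableEq

/-- Index of a basis vector: a generator family together with an integer degree. -/
abbrev N2Idx : Type := N2Gen × ℤ

/-- ℤ/2-parity of a basis vector: `false` = even (`L`, `H`), `true` = odd (`G`, `Q`). -/
def N2parity : N2Idx → Bool
  | (N2Gen.L, _) => false
  | (N2Gen.H, _) => false
  | (N2Gen.G, _) => true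
  | (N2Gen.Q, _) => true

/-- The underlying vector space of the centerless topological N=2 superconformal
algebra: the free ℂ-module on the basis indexed by `N2Idx`. -/
abbrev TopN2 : Type := N2Idx →₀ ℂ

/-- The basis vector `L_n`, `H_n`, `G_n` or `Q_n`. -/
def bT (g : N2Gen) (n : ℤ) : TopN2 := Finsupp.single (g, n) 1

/-- The basis vector with index `i`. -/
def sing (i : N2Idx) : TopN2 := Finsupp.single i 1

/-- The bracket on basis vectors, given by the structure constants of the
centerless topological N=2 superconformal algebra:
`[L_m,L_n] = (m−n)L_{m+n}`, `[L_m,H_n] = −n H_{m+n}`, `[L_m,G_n] = (m−n)G_{m+n}`,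
`[L_m,Q_n] = −n Q_{m+n}`, `[H_m,G_n] = G_{m+n}`, `[H_m,Q_n] = −Q_{m+n}`,
`[G_m,Q_n] = 2L_{m+n} − 2n H_{m+n}`, extended super-skew-symmetrically,
all other brackets of basis vectors being zero. -/
def bracketAux : N2Idx → N2Idx → TopN2
  | (N2Gen.L, m), (N2Gen.L, n) => (m - n : ℂ) • bT N2Gen.L (m + n)
  | (N2Gen.L, m), (N2Gen.H, n) => (-n : ℂ) • bT N2Gen.H (m + n)
  | (N2Gen.H, m), (N2Gen.L, n) => (m : ℂ) • bT N2Gen.H (m + n)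
  | (N2Gen.L, m), (N2Gen.G, n) => (m - n : ℂ) • bT N2Gen.G (m + n)
  | (N2Gen.G, m), (N2Gen.L, n) => (m - n : ℂ) • bT N2Gen.G (m + n)
  | (N2Gen.L, m), (N2Gen.Q, n) => (-n : ℂ) • bT N2Gen.Q (m + n)
  | (N2Gen.Q, m), (N2Gen.L, n) => (m : ℂ) • bT N2Gen.Q (m + n)
  | (N2Gen.H, m), (N2Gen.G, n) => bT N2Gen.G (m + n)
  | (N2Gen.G, m), (N2Gen.H, n) => -(bT N2Gen.G (m + n))
  | (N2Gen.H, m), (N2Gen.Q, n) => -(bT N2Gen.Q (m + n))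
  | (N2Gen.Q, m), (N2Gen.H, n) => bT N2Gen.Q (m + n)
  | (N2Gen.G, m), (N2Gen.Q, n) =>
      (2 : ℂ) • bT N2Gen.L (m + n) + (-2 * n : ℂ) • bT N2Gen.H (m + n)
  | (N2Gen.Q, m), (N2Gen.G, n) =>
      (2 : ℂ) • bT N2Gen.L (m + n) + (-2 * m : ℂ) • bT N2Gen.H (m + n)
  | _, _ => 0

/-- The super-bracket of `T`, extended bilinearly from the basis. -/
def brk (x y : TopN2) : TopN2 :=
  x.sum fun i a => y.sum fun j b => (a * b) • bracketAux i j

/-- The sign `(−1)^b` for a parity `b : Bool` (`false ↦ 1`, `true ↦ −1`). -/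
def psgn (b : Bool) : ℂ := if b then -1 else 1

/-- The Koszul sign `(−1)^{[i][j]}` for two basis indices. -/
def ksgn (i j : N2Idx) : ℂ := psgn (N2parity i && N2parity j)

/-- `x` is ℤ/2-homogeneous of parity `q` (i.e. `x ∈ T^q`). -/
def IsParityT (q : Bool) (x : TopN2) : Prop := ∀ i ∈ x.support, N2parity i = q

/-- `x` is ℤ-homogeneous of degree `n` (i.e. `x ∈ T_n = span{L_n,H_n,G_n,Q_n}`). -/
def IsDegT (n : ℤ) (x : TopN2) : Prop := ∀ i ∈ x.support, i.2 = n

/-- The tensor square `T ⊗ T`, modelled as the free ℂ-module on pairs of indices. -/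
abbrev TT : Type := (N2Idx × N2Idx) →₀ ℂ

/-- Parity of a basis vector `e_{q.1} ⊗ e_{q.2}` of `T ⊗ T`. -/
def pparity (q : N2Idx × N2Idx) : Bool := xor (N2parity q.1) (N2parity q.2)

/-- `v ∈ T ⊗ T` is ℤ/2-homogeneous of parity `p`. -/
def IsParityTT (p : Bool) (v : TT) : Prop := ∀ q ∈ v.support, pparity q = p

/-- `v ∈ T ⊗ T` is ℤ-homogeneous of degree `n`, i.e. `v ∈ V_n = Σ_{j+k=n} T_j ⊗ T_k`. -/
def IsDegTT (n : ℤ) (v : TT) : Prop := ∀ q ∈ v.support, q.1.2 + q.2.2 = n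

/-- The tensor product map `T × T → T ⊗ T`. -/
def tmul2 (x y : TopN2) : TT :=
  x.sum fun i a => y.sum fun j b => Finsupp.single (i, j) (a * b)

/-- Adjoint diagonal action of the basis vector `e_i` on the basis tensor
`e_{q.1} ⊗ e_{q.2}`:  `[e_i,e_{q.1}] ⊗ e_{q.2} + (−1)^{[i][q.1]} e_{q.1} ⊗ [e_i,e_{q.2}]`. -/
def actB (i : N2Idx) (q : N2Idx × N2Idx) : TT :=
  tmul2 (bracketAux i q.1) (sing q.2) + ksgn i q.1 • tmul2 (sing q.1) (bracketAux i q.2)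

/-- The adjoint diagonal action `x · v` of `T` on `V = T ⊗ T`:
`x·(Σ aᵢ⊗bᵢ) = Σ([x,aᵢ]⊗bᵢ + (−1)^{[x][aᵢ]} aᵢ⊗[x,bᵢ])`. -/
def adT2 (x : TopN2) (v : TT) : TT :=
  x.sum fun i a => v.sum fun q c => (a * c) • actB i q

/-- The super-twist map `τ : T⊗T → T⊗T`, `τ(x₁⊗x₂) = (−1)^{[x₁][x₂]} x₂⊗x₁`. -/
def twist (v : TT) : TT :=
  v.sum fun q c => (ksgn q.1 q.2 * c) • Finsupp.single (q.2, q.1) (1 : ℂ)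

/-- The inner derivation `a_inn : x ↦ (−1)^{[a][x]} x·a` attached to `a ∈ T⊗T`
(extended bilinearly over the homogeneous components of `a` and `x`). -/
def innerDer (a : TT) (x : TopN2) : TT :=
  x.sum fun i c => a.sum fun q e =>
    (c * e * psgn (pparity q && N2parity i)) • actB i q

/-- `d : T → V = T⊗T` is a homogeneous super-derivation of parity `p`:
it is ℂ-linear, maps `T^q` into `V^{q+p}`, and satisfies the super Leibniz rule
`d([x,y]) = (−1)^{p[x]} x·d(y) − (−1)^{[y](p+[x])} y·d(x)` on homogeneous elements. -/
def IsHomogDer (p : Bool) (d : TopN2 → TT) : Prop :=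
  (∀ x y : TopN2, d (x + y) = d x + d y) ∧
  (∀ (c : ℂ) (x : TopN2), d (c • x) = c • d x) ∧
  (∀ (q : Bool) (x : TopN2), IsParityT q x → IsParityTT (xor p q) (d x)) ∧
  (∀ (qx qy : Bool) (x y : TopN2), IsParityT qx x → IsParityT qy y →
    d (brk x y) = psgn (p && qx) • adT2 x (d y) - psgn (qy && (xor p qx)) • adT2 y (d x))

/-- The tensor cube `T ⊗ T ⊗ T`, modelled as the free ℂ-module on triples of indices. -/
abbrev TTT : Type := (N2Idx × N2Idx × N2Idx) →₀ ℂ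

/-- The tensor product map `T × T × T → T ⊗ T ⊗ T`. -/
def tmul3 (x y z : TopN2) : TTT :=
  x.sum fun i a => y.sum fun j b => z.sum fun k c => Finsupp.single (i, j, k) (a * b * c)

/-- Adjoint diagonal action of the basis vector `e_i` on a basis vector of `T⊗T⊗T`. -/
def actB3 (i : N2Idx) (q : N2Idx × N2Idx × N2Idx) : TTT :=
  tmul3 (bracketAux i q.1) (sing q.2.1) (sing q.2.2)
    + ksgn i q.1 • tmul3 (sing q.1) (bracketAux i q.2.1) (sing q.2.2)
    + (ksgn i q.1 * ksgn i q.2.1) • tmul3 (sing q.1) (sing q.2.1) (bracketAux i q.2.2)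

/-- The adjoint diagonal action `x · w` of `T` on `T ⊗ T ⊗ T`. -/
def adT3 (x : TopN2) (w : TTT) : TTT :=
  x.sum fun i a => w.sum fun q c => (a * c) • actB3 i q

/-- The classical Yang–Baxter expression
`c(r) = [r^{12},r^{13}] + [r^{12},r^{23}] + [r^{13},r^{23}] ∈ T⊗T⊗T` for `r ∈ T⊗T`,
written out on homogeneous components with the Koszul signs of the super setting:
for components `a⊗b` and `a'⊗b'` of `r`, the summand is
`(−1)^{[a'][b]} [a,a']⊗b⊗b' + a⊗[b,a']⊗b' + (−1)^{[a'][b]} a⊗a'⊗[b,b']`. -/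
def cybe (r : TT) : TTT :=
  r.sum fun q α => r.sum fun q' β => (α * β) •
    ( ksgn q'.1 q.2 • tmul3 (bracketAux q.1 q'.1) (sing q.2) (sing q'.2)
      + tmul3 (sing q.1) (bracketAux q.2 q'.1) (sing q'.2)
      + ksgn q'.1 q.2 • tmul3 (sing q.1) (sing q'.1) (bracketAux q.2 q'.2) )

/-- Tensoring a basis vector of `T` on the left of an element of `T⊗T`. -/
def embedL (i : N2Idx) (w : TT) : TTT :=
  w.sum fun q c => Finsupp.single (i, q.1, q.2) c

/-- The super-cyclic map `ξ : T⊗T⊗T → T⊗T⊗T`,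
`ξ(x₁⊗x₂⊗x₃) = (−1)^{[x₁]([x₂]+[x₃])} x₂⊗x₃⊗x₁`. -/
def cyc (w : TTT) : TTT :=
  w.sum fun q c =>
    (psgn (N2parity q.1 && (xor (N2parity q.2.1) (N2parity q.2.2))) * c) •
      Finsupp.single (q.2.1, q.2.2, q.1) (1 : ℂ)

/-- `(1 ⊗ Δ) : T⊗T → T⊗T⊗T` for a (linear) map `Δ : T → T⊗T` of parity `p`,
with the Koszul sign: `(1⊗Δ)(a⊗b) = (−1)^{p[a]} a ⊗ Δ(b)`. -/
def oneTensor (p : Bool) (D : TopN2 → TT) (v : TT) : TTT :=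
  v.sum fun q c => (psgn (p && N2parity q.1) * c) • embedL q.1 (D (sing q.2))

/-- `(T,[·,·],D)` is a Lie super-bialgebra with comultiplication `D` of parity `p`:
`D` is ℂ-linear, respects the grading, has image in `Im(1⊗1 − τ)`, satisfies the
super co-Jacobi identity `(1 + ξ + ξ²)∘(1⊗D)∘D = 0`, and the compatibility
(1-cocycle) condition `D[x,y] = (−1)^{p[x]} x·D(y) − (−1)^{[y](p+[x])} y·D(x)`. -/
def IsLieSuperBialgebra (p : Bool) (D : TopN2 → TT) : Prop :=
  (∀ x y : TopN2, D (x + y) = D x + D y) ∧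
  (∀ (c : ℂ) (x : TopN2), D (c • x) = c • D x) ∧
  (∀ (q : Bool) (x : TopN2), IsParityT q x → IsParityTT (xor p q) (D x)) ∧
  (∀ x : TopN2, ∃ s : TT, D x = s - twist s) ∧
  (∀ x : TopN2,
    oneTensor p D (D x) + cyc (oneTensor p D (D x)) + cyc (cyc (oneTensor p D (D x))) = 0) ∧
  (∀ (qx qy : Bool) (x y : TopN2), IsParityT qx x → IsParityT qy y →
    D (brk x y) = psgn (p && qx) • adT2 x (D y) - psgn (qy && (xor p qx)) • adT2 y (D x))

end

lemma tmul2_sing_right_apply (x : TopN2) (j k l : N2Idx) :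
    tmul2 x (sing j) (k, l) = if l = j then x k else 0 := by
  classical
  simp only [tmul2, sing, mul_zero, Finsupp.single_zero, Finsupp.sum_single_index, mul_one]
  rw [Finsupp.sum_apply]
  simp only [Finsupp.single_apply, Prod.mk.injEq]
  rw [Finsupp.sum, Finset.sum_eq_single k]
  · simp [eq_comm]
  · intro b _ hb
    simp [hb]
  · intro hk
    simp [Finsupp.notMem_support_iff.mp hk]

lemma tmul2_sing_left_apply_of_ne (y : TopN2) {i k : N2Idx} (l : N2Idx) (h : k ≠ i) :
    tmul2 (sing i) y (k, l) = 0 := by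
  classical
  simp only [tmul2, sing]
  rw [Finsupp.sum_single_index (by simp), Finsupp.sum_apply]
  simp only [Finsupp.single_apply, Prod.mk.injEq, h.symm, false_and, if_false]
  simp

lemma adT2_sing_apply_of_row_eq_zero (i k l : N2Idx) (r : TT) (hk : ∀ l', r (k, l') = 0) :
    adT2 (sing i) r (k, l) =
      r.sum fun q c => c * if l = q.2 then bracketAux i q.1 k else 0 := by
  classical
  rw [adT2, sing, Finsupp.sum_single_index (by simp), Finsupp.sum_apply]
  refine Finset.sum_congr rfl fun q hq => ?_
  have hne : k ≠ q.1 := by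
    rintro rfl
    exact Finsupp.mem_support_iff.mp hq (hk q.2)
  simp [actB, tmul2_sing_right_apply, tmul2_sing_left_apply_of_ne _ _ hne]

lemma coeff_eq_zero_of_bracketAux_ne_zero {r : TT} {i k l p : N2Idx}
    (h : adT2 (sing i) r = 0) (hk : ∀ l', r (k, l') = 0)
    (hp : ∀ j, j ≠ p → r (j, l) ≠ 0 → bracketAux i j k = 0)
    (hne : bracketAux i p k ≠ 0) : r (p, l) = 0 := by
  classical
  have key := adT2_sing_apply_of_row_eq_zero i k l r hk
  rw [h, Finsupp.coe_zero, Pi.zero_apply, Finsupp.sum, Finset.sum_eq_single (p, l)] at key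
  · simpa [hne] using key.symm
  · rintro ⟨j, l'⟩ hq hjl
    by_cases hl : l = l'
    · subst hl
      have hj : j ≠ p := fun hj => hjl (by rw [hj])
      simp [hp j hj (Finsupp.mem_support_iff.mp hq)]
    · simp [hl]
  · intro hq
    simp [Finsupp.notMem_support_iff.mp hq]

lemma exists_row_bound (r : TT) :
    ∃ N : ℤ, ∀ (g : N2Gen) (n : ℤ) (l : N2Idx), N ≤ n → r ((g, n), l) = 0 := by
  obtain ⟨N, hN⟩ := (r.support.image fun q => q.1.2).bddAbove
  refine ⟨N + 1, fun g n l hn => ?_⟩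
  by_contra hr
  have := hN (Finset.mem_coe.mpr (Finset.mem_image_of_mem (fun q => q.1.2)
    (Finsupp.mem_support_iff.mpr hr)))
  simp only at this
  omega

/-- If `r ∈ T⊗T` satisfies `x·r = 0` for all `x ∈ T`
(adjoint diagonal action), then `r = 0`. -/
theorem adT2_invariant_eq_zero (r : TT) (h : ∀ x : TopN2, adT2 x r = 0) :
    r = 0 := by
  obtain ⟨N, hN⟩ := exists_row_bound r
  have hm : ∀ p : ℤ, ∃ m : ℤ, N ≤ m + p ∧ (m : ℂ) - p ≠ 0 := fun p => by
    refine ⟨|N| + |p| + 1, ?_, ?_⟩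
    · have := le_abs_self N
      have := neg_abs_le p
      omega
    · have h1 : |N| + |p| + 1 - p ≠ 0 := by
        have := abs_nonneg N
        have := le_abs_self p
        omega
      exact_mod_cast h1
  have hL : ∀ p l, r ((N2Gen.L, p), l) = 0 := fun p l => by
    obtain ⟨m, hm1, hm2⟩ := hm p
    refine coeff_eq_zero_of_bracketAux_ne_zero (k := (N2Gen.L, m + p))
      (h (sing (N2Gen.L, m))) (fun l' => hN _ _ _ hm1) ?_ ?_
    · rintro ⟨_ | _ | _ | _, n⟩ hj - <;> simp_all [bracketAux, bT]
    · simpa [bracketAux, bT] using hm2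
  have hG : ∀ p l, r ((N2Gen.G, p), l) = 0 := fun p l => by
    obtain ⟨m, hm1, hm2⟩ := hm p
    refine coeff_eq_zero_of_bracketAux_ne_zero (k := (N2Gen.G, m + p))
      (h (sing (N2Gen.L, m))) (fun l' => hN _ _ _ hm1) ?_ ?_
    · rintro ⟨_ | _ | _ | _, n⟩ hj - <;> simp_all [bracketAux, bT]
    · simpa [bracketAux, bT] using hm2
  have hQ : ∀ p l, r ((N2Gen.Q, p), l) = 0 := fun p l => by
    obtain ⟨m, hm1, -⟩ := hm p
    refine coeff_eq_zero_of_bracketAux_ne_zero (k := (N2Gen.Q, m + p))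
      (h (sing (N2Gen.H, m))) (fun l' => hN _ _ _ hm1) ?_ ?_
    · rintro ⟨_ | _ | _ | _, n⟩ hj - <;> simp_all [bracketAux, bT]
    · simp [bracketAux, bT]
  have hH : ∀ p l, r ((N2Gen.H, p), l) = 0 := fun p l => by
    obtain ⟨m, hm1, -⟩ := hm p
    refine coeff_eq_zero_of_bracketAux_ne_zero (k := (N2Gen.G, m + p))
      (h (sing (N2Gen.G, m))) (fun l' => hN _ _ _ hm1) ?_ ?_
    · rintro ⟨_ | _ | _ | _, n⟩ hj hr <;> simp_all [bracketAux, bT]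
    · simp [bracketAux, bT]
  ext ⟨⟨_ | _ | _ | _, p⟩, l⟩
  · exact hL p l
  · exact hH p l
  · exact hG p l
  · exact hQ p l
end

section
/- Let T be the centerless topological N=2 superconformal algebra. An element r ∈ Im(1⊗1 − τ) ⊂ T⊗T satisfies the classical Yang–Baxter equation c(r) = 0 if and only if it satisfies the modified Yang–Baxter equation x·c(r) = 0 for all x ∈ T. -/
theorem tmul3_apply (x y z : TopN2) (q : N2Idx × N2Idx × N2Idx) :
    tmul3 x y z q = x q.1 * y q.2.1 * z q.2.2 := by
  obtain ⟨i, j, k⟩ := q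
  simp only [tmul3, Finsupp.sum_apply, Finsupp.single_apply, Prod.mk.injEq]
  rw [Finsupp.sum_eq_single i, Finsupp.sum_eq_single j, Finsupp.sum_eq_single k] <;>
    simp +contextual [Finsupp.sum]

/-- If `p` does not occur as a first tensor factor of `w`, the `p`-component of `e_i · w` only
involves the action of `e_i` on the first tensor factor. -/
theorem adT3_sing_apply (i p : N2Idx) (j : N2Idx × N2Idx) (w : TTT)
    (hp : ∀ q ∈ w.support, q.1 ≠ p) :
    adT3 (sing i) w (p, j) =
      ∑ q ∈ w.support, w q * (bracketAux i q.1 p * if q.2 = j then 1 else 0) := by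
  obtain ⟨j, k⟩ := j
  rw [adT3, sing, Finsupp.sum_single_index (by simp), Finsupp.sum, Finsupp.finsetSum_apply]
  refine Finset.sum_congr rfl fun q hq ↦ ?_
  obtain ⟨a, b, c⟩ := q
  have ha : a ≠ p := hp _ hq
  by_cases hb : b = j <;> by_cases hc : c = k <;>
    simp [actB3, tmul3_apply, sing, ha, hb, hc]

theorem notMem_support_of_adT3_sing_eq_zero {i p a : N2Idx} {w : TTT}
    (hw : adT3 (sing i) w = 0) (hp : ∀ q ∈ w.support, q.1 ≠ p)
    (ha : ∀ q ∈ w.support, q.1 ≠ a → bracketAux i q.1 p = 0) (hne : bracketAux i a p ≠ 0)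
    (j : N2Idx × N2Idx) : (a, j) ∉ w.support := by
  have h := adT3_sing_apply i p j w hp
  rw [hw, Finset.sum_eq_single (a, j)] at h
  · simpa [hne] using h
  · rintro ⟨a', j'⟩ hq hq'
    by_cases hj : j' = j
    · subst hj
      simp [ha _ hq (by rintro rfl; exact hq' rfl)]
    · simp [hj]
  · intro h
    simp [Finsupp.notMem_support_iff.mp h]

/-- `T ⊗ T ⊗ T` has no nonzero `T`-invariants. -/
theorem eq_zero_of_adT3_eq_zero {w : TTT} (hw : ∀ x : TopN2, adT3 x w = 0) : w = 0 := by
  obtain ⟨B, hB⟩ : ∃ B : ℕ, ∀ q ∈ w.support, q.1.2.natAbs ≤ B :=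
    ⟨w.support.sup fun q ↦ q.1.2.natAbs,
      fun q hq ↦ Finset.le_sup (f := fun q ↦ q.1.2.natAbs) hq⟩
  -- For this degree, `e_n` moves every first tensor factor of `w` out of the range of degrees.
  set n : ℤ := 2 * B + 1 with hn
  have hn0 : (n : ℂ) ≠ 0 := by
    have : n ≠ 0 := by omega
    exact_mod_cast this
  have hp : ∀ m : ℤ, m.natAbs ≤ B → ∀ g : N2Gen, ∀ q ∈ w.support, q.1 ≠ (g, n + m) := by
    rintro m hm g q hq h
    have := hB q hq
    rw [h] at this
    simp only at this
    omega
  have hLGQ : ∀ g ≠ N2Gen.H, ∀ m j, ((g, m), j) ∉ w.support := by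
    intro g hg m j hmem
    refine notMem_support_of_adT3_sing_eq_zero (hw (sing (N2Gen.H, n)))
      (hp m (hB _ hmem) (if g = N2Gen.L then N2Gen.H else g)) ?_ ?_ j hmem
    · rintro ⟨⟨_ | _ | _ | _, m'⟩, j'⟩ - <;> cases g <;>
        first
        | exact absurd rfl hg
        | simp +contextual [bracketAux, bT]
    · cases g <;> simp_all [bracketAux, bT]
  have hH : ∀ m j, ((N2Gen.H, m), j) ∉ w.support := by
    intro m j hmem
    refine notMem_support_of_adT3_sing_eq_zero (hw (sing (N2Gen.G, n)))
      (hp m (hB _ hmem) N2Gen.G) ?_ ?_ j hmem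
    · rintro ⟨⟨_ | _ | _ | _, m'⟩, j'⟩ hq
      · exact absurd hq (hLGQ _ (by decide) _ _)
      all_goals simp +contextual [bracketAux, bT]
    · simp [bracketAux, bT]
  refine Finsupp.support_eq_empty.mp (Finset.eq_empty_of_forall_notMem ?_)
  rintro ⟨⟨g, m⟩, j⟩
  by_cases hg : g = N2Gen.H
  exacts [hg ▸ hH m j, hLGQ g hg m j]

/-- An element `r ∈ Im(1⊗1 − τ) ⊂ T⊗T` satisfies the
classical Yang–Baxter equation `c(r) = 0` if and only if it satisfies the
modified Yang–Baxter equation `x·c(r) = 0` for all `x ∈ T`. -/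
theorem cybe_eq_zero_iff_modified_yang_baxter
    (r : TT) (him : ∃ s : TT, r = s - twist s) :
    cybe r = 0 ↔ ∀ x : TopN2, adT3 x (cybe r) = 0 := by
  refine ⟨fun h x ↦ ?_, fun h ↦ eq_zero_of_adT3_eq_zero h⟩
  simp [h, adT3]
end

section
/- Let T be the centerless topological N=2 superconformal algebra and V = T⊗T with the adjoint diagonal action. Then every super-derivation from T to V is inner: Der(T, V) = Inn(T, V). Equivalently, the first cohomology group H¹(T, T⊗T) vanishes. -/
noncomputable section

namespace N2

/-- The bracket of `T` as a bilinear map. -/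
def ad : TopN2 →ₗ[ℂ] TopN2 →ₗ[ℂ] TopN2 :=
  Finsupp.linearCombination ℂ fun i => Finsupp.linearCombination ℂ (bracketAux i)

/-- The adjoint diagonal action on `T ⊗ T` as a bilinear map. -/
def act : TopN2 →ₗ[ℂ] TT →ₗ[ℂ] TT :=
  Finsupp.linearCombination ℂ fun i => Finsupp.linearCombination ℂ (actB i)

/-- The tensor product map as a bilinear map. -/
def tmul : TopN2 →ₗ[ℂ] TopN2 →ₗ[ℂ] TT :=
  Finsupp.linearCombination ℂ fun i =>
    Finsupp.linearCombination ℂ fun j => Finsupp.single (i, j) (1 : ℂ)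

/-- Multiplication of the basis vector `e_k` by the Koszul sign `(−1)^{q[k]}`. -/
def sgnMap (q : Bool) : TopN2 →ₗ[ℂ] TopN2 :=
  Finsupp.linearCombination ℂ fun k => psgn (q && N2parity k) • sing k

lemma brk_eq_ad (x y : TopN2) : brk x y = ad x y := by
  simp [brk, ad, Finsupp.linearCombination_apply, Finsupp.sum, mul_smul, Finset.smul_sum]

lemma adT2_eq_act (x : TopN2) (v : TT) : adT2 x v = act x v := by
  simp [adT2, act, Finsupp.linearCombination_apply, Finsupp.sum, mul_smul, Finset.smul_sum]

lemma tmul2_eq_tmul (x y : TopN2) : tmul2 x y = tmul x y := by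
  simp [tmul2, tmul, Finsupp.linearCombination_apply, Finsupp.sum, Finset.smul_sum]

@[simp] lemma ad_sing (i j : N2Idx) : ad (sing i) (sing j) = bracketAux i j := by
  simp [ad, sing]

@[simp] lemma act_sing_single (i : N2Idx) (q : N2Idx × N2Idx) :
    act (sing i) (Finsupp.single q 1) = actB i q := by
  simp [act, sing]

@[simp] lemma tmul_sing (i j : N2Idx) : tmul (sing i) (sing j) = Finsupp.single (i, j) 1 := by
  simp [tmul, sing]

@[simp] lemma sgnMap_sing (q : Bool) (k : N2Idx) :
    sgnMap q (sing k) = psgn (q && N2parity k) • sing k := by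
  simp [sgnMap, sing]

lemma single_eq_smul_sing (i : N2Idx) (c : ℂ) : (Finsupp.single i c : TopN2) = c • sing i := by
  simp [sing]

lemma bT_eq_sing (g : N2Gen) (n : ℤ) : bT g n = sing (g, n) := rfl

/-- Linear maps out of `T` are determined by their values on the basis. -/
lemma hom_ext {M : Type*} [AddCommGroup M] [Module ℂ M] {f g : TopN2 →ₗ[ℂ] M}
    (h : ∀ i, f (sing i) = g (sing i)) : f = g :=
  Finsupp.lhom_ext' fun i => LinearMap.ext_ring (h i)

/-- Induction on vectors of `T ⊗ T` of a given parity. -/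
lemma homog_induction_tensor {q : Bool} {P : TT → Prop} (h0 : P 0)
    (hadd : ∀ x y, P x → P y → P (x + y))
    (hs : ∀ k (c : ℂ), pparity k = q → P (c • Finsupp.single k 1))
    {v : TT} (hv : IsParityTT q v) : P v := by
  rw [← Finsupp.sum_single v]
  refine Finset.sum_induction _ P hadd h0 fun k hk => ?_
  rw [← mul_one (v k), ← smul_eq_mul, ← Finsupp.smul_single]
  exact hs k _ (hv k hk)

/-- Induction on vectors of `T` of a given parity. -/
lemma homog_induction {q : Bool} {P : TopN2 → Prop} (h0 : P 0)
    (hadd : ∀ x y, P x → P y → P (x + y)) (hs : ∀ i (c : ℂ), N2parity i = q → P (c • sing i))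
    {x : TopN2} (hx : IsParityT q x) : P x := by
  rw [← Finsupp.sum_single x]
  refine Finset.sum_induction _ P hadd h0 fun i hi => ?_
  rw [single_eq_smul_sing]
  exact hs i _ (hx i hi)

lemma psgn_mul (a b : Bool) : psgn a * psgn b = psgn (xor a b) := by
  cases a <;> cases b <;> simp [psgn]

lemma isParityT_sing (i : N2Idx) : IsParityT (N2parity i) (sing i) := by
  intro k hk
  rw [sing] at hk
  rw [Finsupp.mem_support_single] at hk
  rw [hk.1]

lemma isParityT_add {q : Bool} {x y : TopN2} (hx : IsParityT q x) (hy : IsParityT q y) :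
    IsParityT q (x + y) := fun i hi => by
  rcases Finset.mem_union.1 (Finsupp.support_add hi) with h | h
  exacts [hx i h, hy i h]

lemma isParityT_smul {q : Bool} (c : ℂ) {x : TopN2} (hx : IsParityT q x) :
    IsParityT q (c • x) := fun i hi => hx i (Finsupp.support_smul hi)

lemma isParityTT_add {q : Bool} {x y : TT} (hx : IsParityTT q x) (hy : IsParityTT q y) :
    IsParityTT q (x + y) := fun i hi => by
  rcases Finset.mem_union.1 (Finsupp.support_add hi) with h | h
  exacts [hx i h, hy i h]

lemma isParityTT_smul {q : Bool} (c : ℂ) {x : TT} (hx : IsParityTT q x) :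
    IsParityTT q (c • x) := fun i hi => hx i (Finsupp.support_smul hi)

lemma isParityTT_zero (q : Bool) : IsParityTT q 0 := fun i hi => by simp at hi

lemma isParityT_bracketAux (i j : N2Idx) :
    IsParityT (xor (N2parity i) (N2parity j)) (bracketAux i j) := by
  rcases i with ⟨i, m⟩
  rcases j with ⟨j, n⟩
  have h0 : ∀ b, IsParityT b (0 : TopN2) := fun b k hk => by simp at hk
  have hL : IsParityT false (bT .L (m + n)) := isParityT_sing _
  have hH : IsParityT false (bT .H (m + n)) := isParityT_sing _
  have hG : IsParityT true (bT .G (m + n)) := isParityT_sing _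
  have hQ : IsParityT true (bT .Q (m + n)) := isParityT_sing _
  cases i <;> cases j <;> simp only [bracketAux, N2parity, Bool.xor_false, Bool.xor_true,
    Bool.not_true, Bool.not_false, ← neg_one_smul ℂ (bT _ _)] <;>
    generalize bT .L (m + n) = l, bT .H (m + n) = h, bT .G (m + n) = g, bT .Q (m + n) = q at * <;>
    first
    | with_reducible exact isParityT_add (isParityT_smul _ hL) (isParityT_smul _ hH)
    | with_reducible exact isParityT_smul _ hL
    | with_reducible exact isParityT_smul _ hH
    | with_reducible exact isParityT_smul _ hG
    | with_reducible exact isParityT_smul _ hQ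
    | with_reducible exact hG
    | with_reducible exact hQ
    | with_reducible exact h0 _

lemma isParityT_ad {p q : Bool} {x y : TopN2} (hx : IsParityT p x) (hy : IsParityT q y) :
    IsParityT (xor p q) (ad x y) := by
  have h0 : IsParityT (xor p q) (0 : TopN2) := fun k hk => by simp at hk
  refine homog_induction (P := fun x => IsParityT (xor p q) (ad x y)) (by simpa)
    (fun x x' h h' => by rw [map_add, LinearMap.add_apply]; exact isParityT_add h h') ?_ hx
  intro i c hi
  rw [map_smul, LinearMap.smul_apply]
  refine isParityT_smul c ?_
  refine homog_induction (P := fun y => IsParityT (xor p q) (ad (sing i) y)) (by simpa)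
    (fun y y' h h' => by rw [map_add]; exact isParityT_add h h') ?_ hy
  intro j c' hj
  rw [map_smul, ad_sing, ← hi, ← hj]
  exact isParityT_smul c' (isParityT_bracketAux i j)

lemma tmul_apply (x y : TopN2) (q : N2Idx × N2Idx) : tmul x y q = x q.1 * y q.2 := by
  have : tmul.compr₂ (Finsupp.lapply q) =
      (LinearMap.mul ℂ ℂ).compl₁₂ (Finsupp.lapply q.1) (Finsupp.lapply q.2) := by
    refine hom_ext fun i => hom_ext fun j => ?_
    rcases q with ⟨a, b⟩
    simp only [LinearMap.compr₂_apply, tmul_sing, LinearMap.compl₁₂_apply, Finsupp.lapply_apply,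
      LinearMap.mul_apply']
    simp only [sing, Finsupp.single_apply, Prod.mk.injEq]
    split_ifs <;> simp_all
  exact LinearMap.congr_fun₂ this x y

lemma tmul_hom_ext {M : Type*} [AddCommGroup M] [Module ℂ M] {f g : TT →ₗ[ℂ] M}
    (h : ∀ x y, f (tmul x y) = g (tmul x y)) : f = g := by
  refine Finsupp.lhom_ext' fun i => LinearMap.ext_ring ?_
  simpa using h (sing i.1) (sing i.2)

lemma isParityTT_tmul {p q : Bool} {x y : TopN2} (hx : IsParityT p x) (hy : IsParityT q y) :
    IsParityTT (xor p q) (tmul x y) := by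
  intro k hk
  rw [Finsupp.mem_support_iff, tmul_apply] at hk
  rw [pparity, hx k.1 (Finsupp.mem_support_iff.2 (left_ne_zero_of_mul hk)),
    hy k.2 (Finsupp.mem_support_iff.2 (right_ne_zero_of_mul hk))]

lemma jacobi (i j : N2Idx) :
    ad (bracketAux i j) = ad (sing i) ∘ₗ ad (sing j) - ksgn i j • (ad (sing j) ∘ₗ ad (sing i)) := by
  refine hom_ext fun k => ?_
  rcases i with ⟨i, l⟩
  rcases j with ⟨j, m⟩
  rcases k with ⟨k, n⟩
  have e1 : l + (m + n) = l + m + n := by ring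
  have e2 : m + (l + n) = l + m + n := by ring
  cases i <;> cases j <;> cases k <;>
    simp [bracketAux, bT_eq_sing, ksgn, psgn, N2parity, e1, e2] <;> try module

lemma sgnMap_of_isParityT (r : Bool) {q : Bool} {x : TopN2} (hx : IsParityT q x) :
    sgnMap r x = psgn (r && q) • x := by
  refine homog_induction (P := fun x => sgnMap r x = psgn (r && q) • x) (by simp)
    (fun x y hx hy => by rw [map_add, hx, hy, smul_add]) (fun i c hi => ?_) hx
  rw [map_smul, sgnMap_sing, hi, smul_comm]

lemma sgnMap_ad (r : Bool) (i : N2Idx) (u : TopN2) :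
    sgnMap r (ad (sing i) u) = psgn (r && N2parity i) • ad (sing i) (sgnMap r u) := by
  have : sgnMap r ∘ₗ ad (sing i) = psgn (r && N2parity i) • ad (sing i) ∘ₗ sgnMap r := by
    refine hom_ext fun k => ?_
    simp only [LinearMap.comp_apply, LinearMap.smul_apply, ad_sing, sgnMap_sing, map_smul,
      sgnMap_of_isParityT r (isParityT_bracketAux i k), smul_smul, psgn_mul]
    congr 2
    cases r <;> simp
  exact LinearMap.congr_fun this u

lemma sgnMap_sgnMap (r s : Bool) (u : TopN2) : sgnMap r (sgnMap s u) = sgnMap (xor r s) u := by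
  have : sgnMap r ∘ₗ sgnMap s = sgnMap (xor r s) := by
    refine hom_ext fun k => ?_
    simp only [LinearMap.comp_apply, sgnMap_sing, map_smul, smul_smul, psgn_mul]
    congr 2
    cases r <;> cases s <;> simp
  exact LinearMap.congr_fun this u

lemma act_sing_tmul (i : N2Idx) (u w : TopN2) : act (sing i) (tmul u w) =
    tmul (ad (sing i) u) w + tmul (sgnMap (N2parity i) u) (ad (sing i) w) := by
  have : tmul.compr₂ (act (sing i)) = tmul.compl₁₂ (ad (sing i)) LinearMap.id +
      tmul.compl₁₂ (sgnMap (N2parity i)) (ad (sing i)) := by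
    refine hom_ext fun a => hom_ext fun b => ?_
    simp [actB, ksgn, tmul2_eq_tmul]
  exact LinearMap.congr_fun₂ this u w

lemma act_tmul {q : Bool} {x : TopN2} (hx : IsParityT q x) (u w : TopN2) :
    act x (tmul u w) = tmul (ad x u) w + tmul (sgnMap q u) (ad x w) := by
  refine homog_induction (P := fun x => act x (tmul u w) =
    tmul (ad x u) w + tmul (sgnMap q u) (ad x w)) (by simp) (fun x y hx hy => ?_)
    (fun i c hi => ?_) hx
  · simp only [map_add, LinearMap.add_apply, hx, hy]
    abel
  · simp only [map_smul, LinearMap.smul_apply, act_sing_tmul, hi, smul_add]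

/-- `T ⊗ T` is a `T`-module, on basis vectors. -/
lemma act_bracketAux (i j : N2Idx) (v : TT) : act (bracketAux i j) v =
    act (sing i) (act (sing j) v) - ksgn i j • act (sing j) (act (sing i) v) := by
  have : act (bracketAux i j) = act (sing i) ∘ₗ act (sing j) -
      ksgn i j • act (sing j) ∘ₗ act (sing i) := by
    refine tmul_hom_ext fun u w => ?_
    rw [act_tmul (isParityT_bracketAux i j), jacobi]
    simp only [LinearMap.sub_apply, LinearMap.smul_apply, LinearMap.comp_apply, act_sing_tmul,
      map_add, sgnMap_ad, sgnMap_sgnMap, map_sub, map_smul, smul_add, smul_smul, ksgn, psgn_mul,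
      Bool.and_comm (N2parity j) (N2parity i), Bool.xor_comm (N2parity j) (N2parity i),
      Bool.xor_self]
    simp only [psgn, Bool.false_eq_true, if_false, one_smul]
    abel
  exact LinearMap.congr_fun this v

/-- `T ⊗ T` is a `T`-module, on homogeneous vectors. -/
lemma act_ad {p q : Bool} {x y : TopN2} (hx : IsParityT p x) (hy : IsParityT q y) (v : TT) :
    act (ad x y) v = act x (act y v) - psgn (p && q) • act y (act x v) := by
  refine homog_induction (P := fun x => act (ad x y) v =
    act x (act y v) - psgn (p && q) • act y (act x v)) (by simp) (fun x x' h h' => ?_)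
    (fun i c hi => ?_) hx
  · simp only [map_add, LinearMap.add_apply, h, h', smul_add]
    abel
  simp only [map_smul, LinearMap.smul_apply, smul_comm _ c, ← smul_sub]
  congr 1
  refine homog_induction (P := fun y => act (ad (sing i) y) v =
    act (sing i) (act y v) - psgn (p && q) • act y (act (sing i) v)) (by simp)
    (fun y y' h h' => ?_) (fun j c hj => ?_) hy
  · simp only [map_add, LinearMap.add_apply, h, h', smul_add]
    abel
  simp only [map_smul, LinearMap.smul_apply, smul_comm _ c, ← smul_sub, ad_sing, act_bracketAux,
    ksgn, hi, hj]

lemma isParityTT_act {p q : Bool} {x : TopN2} {v : TT} (hx : IsParityT p x)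
    (hv : IsParityTT q v) : IsParityTT (xor p q) (act x v) := by
  refine homog_induction (P := fun x => IsParityTT (xor p q) (act x v))
    (by simpa using isParityTT_zero _)
    (fun x x' h h' => by rw [map_add, LinearMap.add_apply]; exact isParityTT_add h h') ?_ hx
  intro i c hi
  rw [map_smul, LinearMap.smul_apply]
  refine isParityTT_smul c ?_
  refine homog_induction_tensor (P := fun v => IsParityTT (xor p q) (act (sing i) v))
    (by simpa using isParityTT_zero _)
    (fun x y h h' => by rw [map_add]; exact isParityTT_add h h') (fun k c hk => ?_) hv
  rw [map_smul]
  refine isParityTT_smul _ ?_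
  rw [← Prod.mk.eta (p := k), ← tmul_sing, act_sing_tmul, sgnMap_sing, ← hi, ← hk, pparity]
  refine isParityTT_add ?_ ?_
  · rw [← Bool.xor_assoc, ad_sing]
    exact isParityTT_tmul (isParityT_bracketAux i k.1) (isParityT_sing _)
  · rw [← Bool.xor_assoc, Bool.xor_comm (N2parity i), Bool.xor_assoc, ad_sing]
    exact isParityTT_tmul (isParityT_smul _ (isParityT_sing _)) (isParityT_bracketAux i k.2)

/-- `innerDer` as a bilinear map. -/
def inner : TT →ₗ[ℂ] TopN2 →ₗ[ℂ] TT :=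
  Finsupp.linearCombination ℂ fun q =>
    Finsupp.linearCombination ℂ fun i => psgn (pparity q && N2parity i) • actB i q

lemma innerDer_eq_inner (a : TT) (x : TopN2) : innerDer a x = inner a x := by
  simp only [innerDer, inner, Finsupp.linearCombination_apply, Finsupp.sum,
    LinearMap.sum_apply, LinearMap.smul_apply, Finset.smul_sum]
  rw [Finset.sum_comm]
  refine Finset.sum_congr rfl fun i _ => Finset.sum_congr rfl fun q _ => ?_
  module

lemma inner_apply {p q : Bool} {a : TT} {x : TopN2} (ha : IsParityTT p a) (hx : IsParityT q x) :
    inner a x = psgn (p && q) • act x a := by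
  refine homog_induction (P := fun x => inner a x = psgn (p && q) • act x a) (by simp)
    (fun x y hx hy => by rw [map_add, map_add, hx, hy, LinearMap.add_apply, smul_add])
    (fun i c hi => ?_) hx
  simp only [map_smul, LinearMap.smul_apply, smul_comm _ c]
  congr 1
  refine homog_induction_tensor (P := fun a => inner a (sing i) = psgn (p && q) • act (sing i) a)
    (by simp) (fun x y hx hy => by rw [map_add, map_add, LinearMap.add_apply, hx, hy, smul_add])
    (fun k c hk => ?_) ha
  simp only [map_smul, LinearMap.smul_apply, act_sing_single, smul_comm _ c]
  simp [inner, sing, hi, hk]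

lemma isHomogDer_innerDer {p : Bool} {a : TT} (ha : IsParityTT p a) :
    IsHomogDer p (innerDer a) := by
  refine ⟨fun x y => ?_, fun c x => ?_, fun q x hx => ?_, fun qx qy x y hx hy => ?_⟩
  · simp only [innerDer_eq_inner, map_add]
  · simp only [innerDer_eq_inner, map_smul]
  · rw [innerDer_eq_inner, inner_apply ha hx, Bool.xor_comm]
    exact isParityTT_smul _ (isParityTT_act hx ha)
  · simp only [innerDer_eq_inner, brk_eq_ad, adT2_eq_act, inner_apply ha hx, inner_apply ha hy,
      inner_apply ha (isParityT_ad hx hy), act_ad hx hy, map_smul, smul_smul, psgn_mul, smul_sub]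
    cases p <;> cases qx <;> cases qy <;> rfl

lemma isHomogDer_sub {p : Bool} {d d' : TopN2 → TT} (hd : IsHomogDer p d)
    (hd' : IsHomogDer p d') : IsHomogDer p (d - d') := by
  obtain ⟨h1, h2, h3, h4⟩ := hd
  obtain ⟨h1', h2', h3', h4'⟩ := hd'
  refine ⟨fun x y => ?_, fun c x => ?_, fun q x hx => ?_, fun qx qy x y hx hy => ?_⟩
  · simp only [Pi.sub_apply, h1, h1']
    abel
  · simp only [Pi.sub_apply, h2, h2', smul_sub]
  · rw [Pi.sub_apply, sub_eq_add_neg, ← neg_one_smul ℂ]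
    exact isParityTT_add (h3 q x hx) (isParityTT_smul _ (h3' q x hx))
  · simp only [Pi.sub_apply, h4 qx qy x y hx hy, h4' qx qy x y hx hy, adT2_eq_act, map_sub,
      smul_sub]
    abel

lemma leibniz_sing {p : Bool} {d : TopN2 → TT} (hd : IsHomogDer p d) (i j : N2Idx) :
    d (bracketAux i j) = psgn (p && N2parity i) • act (sing i) (d (sing j)) -
      psgn (N2parity j && xor p (N2parity i)) • act (sing j) (d (sing i)) := by
  rw [← ad_sing, ← brk_eq_ad, hd.2.2.2 _ _ _ _ (isParityT_sing i) (isParityT_sing j),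
    adT2_eq_act, adT2_eq_act]

lemma eq_of_eq_on_sing {p p' : Bool} {d d' : TopN2 → TT} (hd : IsHomogDer p d)
    (hd' : IsHomogDer p' d') (h : ∀ i, d (sing i) = d' (sing i)) : d = d' := by
  let f : TopN2 →ₗ[ℂ] TT := ⟨⟨d, hd.1⟩, hd.2.1⟩
  let f' : TopN2 →ₗ[ℂ] TT := ⟨⟨d', hd'.1⟩, hd'.2.1⟩
  have : f = f' := hom_ext h
  exact congrArg DFunLike.coe this

/-- The eigenvalue of `H_0` on a family of generators. -/
def charge : N2Gen → ℤ
  | .L => 0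
  | .H => 0
  | .G => 1
  | .Q => -1

/-- The eigenvalue of `H_0` on a basis vector of `T ⊗ T`. -/
def charge₂ (q : N2Idx × N2Idx) : ℤ := charge q.1.1 + charge q.2.1

lemma bracketAux_H_zero (i : N2Idx) : bracketAux (.H, 0) i = (charge i.1 : ℂ) • sing i := by
  rcases i with ⟨i, n⟩
  cases i <;> simp [bracketAux, charge, bT_eq_sing]

lemma act_H_zero (v : TT) (q : N2Idx × N2Idx) :
    act (sing (.H, 0)) v q = charge₂ q * v q := by
  induction v using Finsupp.induction_linear with
  | zero => simp
  | add v w hv hw => simp only [map_add, Finsupp.add_apply, hv, hw, mul_add]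
  | single k c =>
    have : act (sing (.H, 0)) (Finsupp.single k 1) = (charge₂ k : ℂ) • Finsupp.single k 1 := by
      rw [act_sing_single, actB, bracketAux_H_zero, bracketAux_H_zero]
      simp only [tmul2_eq_tmul, map_smul, LinearMap.smul_apply, tmul_sing, charge₂]
      simp [ksgn, psgn, N2parity]
    rw [← mul_one c, ← smul_eq_mul, ← Finsupp.smul_single, map_smul, this]
    by_cases h : k = q
    · subst h; simp [mul_comm]
    · simp [h]

/-- `d` preserves the grading by eigenvalues of `H_0`. -/
def PreservesCharge (d : TopN2 → TT) : Prop :=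
  ∀ i q, d (sing i) q ≠ 0 → charge₂ q = charge i.1

/-- A derivation whose value at `H_0` is `H_0`-invariant preserves the `H_0`-grading. -/
lemma preservesCharge_of_H_zero {p : Bool} {d : TopN2 → TT} (hd : IsHomogDer p d)
    (h : act (sing (.H, 0)) (d (sing (.H, 0))) = 0) : PreservesCharge d := by
  intro i q hq
  have h1 := leibniz_sing hd (.H, 0) i
  rw [bracketAux_H_zero, hd.2.1] at h1
  have h2 : act (sing (.H, 0)) (act (sing i) (d (sing (.H, 0)))) =
      (charge i.1 : ℂ) • act (sing i) (d (sing (.H, 0))) := by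
    have := act_bracketAux (.H, 0) i (d (sing (.H, 0)))
    rw [h, map_zero, smul_zero, sub_zero, bracketAux_H_zero, map_smul] at this
    exact this.symm
  have h1q := DFunLike.congr_fun h1 q
  have h2q := DFunLike.congr_fun h2 q
  simp only [N2parity, Bool.and_false, Bool.xor_false, Finsupp.smul_apply, Finsupp.sub_apply,
    smul_eq_mul, act_H_zero] at h1q h2q
  generalize act (sing i) (d (sing (.H, 0))) q = u at h1q h2q
  have hε : psgn (N2parity i && p) ≠ 0 := by
    cases N2parity i <;> cases p <;> simp [psgn]
  by_contra hne
  have hne' : (charge₂ q : ℂ) - charge i.1 ≠ 0 := sub_ne_zero.2 (by exact_mod_cast hne)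
  have hu : u = 0 := by
    have : ((charge₂ q : ℂ) - charge i.1) * u = 0 := by linear_combination h2q
    exact (mul_eq_zero.1 this).resolve_left hne'
  have : ((charge₂ q : ℂ) - charge i.1) * d (sing i) q = 0 := by
    rw [hu] at h1q
    simp only [psgn, Bool.false_eq_true, if_false] at h1q
    linear_combination -h1q
  exact (mul_ne_zero hne' hq) this

/-- Every homogeneous derivation preserves the `H_0`-grading up to an inner derivation. -/
lemma exists_preservesCharge {p : Bool} {d : TopN2 → TT} (hd : IsHomogDer p d) :
    ∃ a, IsParityTT p a ∧ PreservesCharge (d - innerDer a) := by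
  set v := d (sing (.H, 0)) with hv
  have hvp : IsParityTT p v := by
    have := hd.2.2.1 _ _ (isParityT_sing (.H, 0))
    rwa [show N2parity (.H, 0) = false from rfl, Bool.xor_false] at this
  let a : TT := Finsupp.onFinset v.support (fun q => v q / charge₂ q) fun q hq => by
    rw [Finsupp.mem_support_iff]
    rintro h
    simp [h] at hq
  have ha : IsParityTT p a := fun q hq => hvp q (Finsupp.support_onFinset_subset hq)
  refine ⟨a, ha, preservesCharge_of_H_zero (isHomogDer_sub hd (isHomogDer_innerDer ha)) ?_⟩
  ext q
  rw [act_H_zero, Pi.sub_apply, innerDer_eq_inner, inner_apply ha (isParityT_sing _), ← hv]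
  simp only [N2parity, Bool.and_false, psgn, Bool.false_eq_true, if_false, one_smul,
    Finsupp.sub_apply, act_H_zero, Finsupp.coe_zero, Pi.zero_apply, a, Finsupp.onFinset_apply]
  by_cases h : (charge₂ q : ℂ) = 0
  · simp [h]
  · field_simp
    ring

lemma pparity_eq_of_charge {q : N2Idx × N2Idx} {i : N2Idx} (h : charge₂ q = charge i.1) :
    pparity q = N2parity i := by
  rcases q with ⟨⟨a, _⟩, ⟨b, _⟩⟩
  rcases i with ⟨i, _⟩
  cases a <;> cases b <;> cases i <;> simp_all [charge₂, charge, pparity, N2parity]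

lemma eq_zero_of_odd {d : TopN2 → TT} (hd : IsHomogDer true d) (hc : PreservesCharge d) :
    d = 0 := by
  refine eq_of_eq_on_sing (p' := true) hd ?_ fun i => ?_
  · exact ⟨fun _ _ => by simp, fun _ _ => by simp, fun _ _ _ => isParityTT_zero _,
      fun _ _ _ _ _ _ => by simp [adT2_eq_act]⟩
  · ext q
    by_contra hq
    have h1 := pparity_eq_of_charge (hc i q hq)
    have h2 := hd.2.2.1 _ _ (isParityT_sing i) q (Finsupp.mem_support_iff.2 hq)
    rw [h1] at h2
    cases h : N2parity i <;> simp [h] at h2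

instance : Fintype N2Gen := ⟨{.L, .H, .G, .Q}, fun g => by cases g <;> simp⟩

/-- Laurent polynomials in two variables `x` and `y`. -/
abbrev Laurent : Type := AddMonoidAlgebra ℂ (ℤ × ℤ)

/-- The monomial `x^i y^j`. -/
def mon (i j : ℤ) : Laurent := AddMonoidAlgebra.single (i, j) 1

/-- Families of Laurent polynomials indexed by pairs of generator families; the coefficient of
`x^i y^j` in the entry `(g, g')` stands for the coefficient of `g_i ⊗ g'_j`. -/
abbrev Symb : Type := N2Gen → N2Gen → Laurent

lemma mon_mul_mon (i j k l : ℤ) : mon i j * mon k l = mon (i + k) (j + l) := by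
  simp [mon, AddMonoidAlgebra.single_mul_single]

lemma mon_zero : mon 0 0 = 1 := rfl

lemma laurent_induction {P : Laurent → Prop} (h0 : P 0) (hadd : ∀ a b, P a → P b → P (a + b))
    (hs : ∀ i j (c : ℂ), P (c • mon i j)) (a : Laurent) : P a := by
  obtain ⟨f⟩ := a
  induction f using Finsupp.induction_linear with
  | zero => exact h0
  | add f g hf hg => exact hadd _ _ hf hg
  | single k c =>
    have := hs k.1 k.2 c
    simp only [mon, AddMonoidAlgebra.smul_single, smul_eq_mul, mul_one, Prod.mk.eta] at this
    exact this

/-- The linear map on Laurent polynomials with given values on monomials. -/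
def monLift {M : Type*} [AddCommGroup M] [Module ℂ M] (f : ℤ → ℤ → M) : Laurent →ₗ[ℂ] M :=
  Finsupp.linearCombination ℂ (fun p : ℤ × ℤ => f p.1 p.2) ∘ₗ
    (AddMonoidAlgebra.coeffLinearEquiv ℂ).toLinearMap

@[simp] lemma monLift_mon {M : Type*} [AddCommGroup M] [Module ℂ M] (f : ℤ → ℤ → M) (i j : ℤ) :
    monLift f (mon i j) = f i j := by
  simp [monLift, mon]

/-- The entries of a tensor. -/
def symb : TT →ₗ[ℂ] Symb :=
  LinearMap.pi fun g => LinearMap.pi fun g' => Finsupp.linearCombination ℂ fun q =>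
    if q.1.1 = g ∧ q.2.1 = g' then mon q.1.2 q.2.2 else 0

lemma symb_single (q : N2Idx × N2Idx) (g g' : N2Gen) : symb (Finsupp.single q 1) g g' =
    if q.1.1 = g ∧ q.2.1 = g' then mon q.1.2 q.2.2 else 0 := by
  simp [symb]

/-- The tensor with given entries. -/
def ofSymb (w : Symb) : TT :=
  ∑ g, ∑ g', monLift (fun i j => Finsupp.single ((g, i), (g', j)) (1 : ℂ)) (w g g')

lemma symb_ofSymb (w : Symb) : symb (ofSymb w) = w := by
  have key : ∀ (h h' g g' : N2Gen) (b : Laurent),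
      symb (monLift (fun i j => Finsupp.single ((h, i), (h', j)) (1 : ℂ)) b) g g' =
        if h = g ∧ h' = g' then b else 0 := by
    intro h h' g g' b
    induction b using laurent_induction with
    | h0 => simp
    | hadd a b ha hb => simp only [map_add, Pi.add_apply, ha, hb]; split_ifs <;> simp
    | hs i j c =>
      simp only [map_smul, Pi.smul_apply, monLift_mon, symb_single]
      split_ifs <;> simp
  ext1 g
  ext1 g'
  simp only [ofSymb, map_sum, Finset.sum_apply, key]
  simp [ite_and]

lemma ofSymb_symb (v : TT) : ofSymb (symb v) = v := by
  induction v using Finsupp.induction_linear with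
  | zero => simp [ofSymb]
  | add v w hv hw =>
    simp only [ofSymb, map_add, Pi.add_apply, Finset.sum_add_distrib] at hv hw ⊢
    rw [hv, hw]
  | single q c =>
    rw [← mul_one c, ← smul_eq_mul, ← Finsupp.smul_single]
    simp only [ofSymb, map_smul, Pi.smul_apply, symb_single, ← Finset.smul_sum]
    congr 1
    simp only [ite_and, apply_ite (monLift _), monLift_mon, map_zero]
    simp

lemma symb_injective : Function.Injective symb :=
  Function.LeftInverse.injective ofSymb_symb

/-- The derivation `x^{n+1} ∂_x + y^{n+1} ∂_y`. -/
def euler (n : ℤ) : Laurent →ₗ[ℂ] Laurent :=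
  monLift fun i j => (i : ℂ) • mon (i + n) j + (j : ℂ) • mon i (j + n)

/-- The conformal weight coefficient in `[L_n, g_i] = (wt g · n − i) g_{n+i}`. -/
def wt : N2Gen → ℂ
  | .L => 1
  | .H => 0
  | .G => 1
  | .Q => 0

/-- The action of `L_n` on entries. -/
def actL (n : ℤ) (w : Symb) : Symb := fun g g' =>
  ((n * wt g : ℂ) • mon n 0 + (n * wt g' : ℂ) • mon 0 n) * w g g' - euler n (w g g')

/-- The bracket with `Q_m` on one tensor factor, `z` being the `m`-th power of its variable. -/
def bracketQ (m : ℤ) (z : Laurent) (u : N2Gen → Laurent) : N2Gen → Laurent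
  | .L => (2 : ℂ) • (z * u .G)
  | .H => (-2 * m : ℂ) • (z * u .G)
  | .G => 0
  | .Q => (m : ℂ) • (z * u .L) + z * u .H

/-- The action of `Q_m` on entries. -/
def actQ (m : ℤ) (w : Symb) : Symb := fun g g' =>
  bracketQ m (mon m 0) (fun h => w h g') g +
    psgn (N2parity (g, 0)) • bracketQ m (mon 0 m) (w g) g'

lemma actQ_add (m : ℤ) (v w : Symb) : actQ m (v + w) = actQ m v + actQ m w := by
  ext1 g
  ext1 g'
  cases g <;> cases g' <;> simp [actQ, bracketQ, psgn, N2parity, mul_add] <;> module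

lemma actQ_smul (m : ℤ) (b : Laurent) (w : Symb) : actQ m (b • w) = b • actQ m w := by
  ext1 g
  ext1 g'
  cases g <;> cases g' <;> simp [actQ, bracketQ, psgn, N2parity, mul_add, mul_left_comm b]

lemma smul_symb (c : ℂ) (w : Symb) : c • w = (c • mon 0 0) • w := by
  simp [mon_zero]

lemma actL_add (n : ℤ) (v w : Symb) : actL n (v + w) = actL n v + actL n w := by
  ext1 g
  ext1 g'
  simp only [actL, Pi.add_apply, mul_add, map_add]
  abel

lemma actL_smul (n : ℤ) (c : ℂ) (w : Symb) : actL n (c • w) = c • actL n w := by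
  ext1 g
  ext1 g'
  simp only [actL, Pi.smul_apply, map_smul, mul_smul_comm, smul_sub]

lemma symb_act_L (n : ℤ) (v : TT) : symb (act (sing (.L, n)) v) = actL n (symb v) := by
  induction v using Finsupp.induction_linear with
  | zero => ext1 g; ext1 g'; simp [actL]
  | add v w hv hw => simp only [map_add, hv, hw, actL_add]
  | single q c =>
    rw [← mul_one c, ← smul_eq_mul, ← Finsupp.smul_single, map_smul, map_smul, map_smul,
      actL_smul, act_sing_single]
    congr 1
    obtain ⟨⟨h, i⟩, ⟨h', j⟩⟩ := q
    have hb : ∀ (k : N2Gen) (i : ℤ), bracketAux (.L, n) (k, i) =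
        (n * wt k - i : ℂ) • sing (k, i + n) := by
      intro k i
      cases k <;> simp [bracketAux, wt, bT_eq_sing, add_comm]
    have hk : ksgn (.L, n) (h, i) = 1 := rfl
    ext1 g
    ext1 g'
    simp only [actB, hb, tmul2_eq_tmul, hk, one_smul, map_smul, LinearMap.smul_apply, tmul_sing,
      map_add, Pi.add_apply, Pi.smul_apply, symb_single, actL]
    split_ifs with h1
    · obtain ⟨rfl, rfl⟩ := h1
      simp only [euler, monLift_mon, add_mul, smul_mul_assoc, mon_mul_mon, zero_add, add_comm n]
      module
    · simp

lemma symb_act_Q (m : ℤ) (v : TT) : symb (act (sing (.Q, m)) v) = actQ m (symb v) := by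
  induction v using Finsupp.induction_linear with
  | zero => ext1 g; ext1 g'; cases g <;> cases g' <;> simp [actQ, bracketQ]
  | add v w hv hw => simp only [map_add, hv, hw, actQ_add]
  | single q c =>
    rw [← mul_one c, ← smul_eq_mul, ← Finsupp.smul_single, map_smul, map_smul, map_smul,
      smul_symb c (symb (Finsupp.single q 1)), actQ_smul, ← smul_symb, act_sing_single]
    congr 1
    obtain ⟨⟨h, i⟩, ⟨h', j⟩⟩ := q
    have h1 : ∀ g g', symb (tmul (bracketAux (.Q, m) (h, i)) (sing (h', j))) g g' =
        bracketQ m (mon m 0) (fun k => symb (Finsupp.single ((h, i), (h', j)) 1) k g') g := by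
      intro g g'
      by_cases hg : h' = g' <;> cases h <;> cases g <;>
        simp [bracketAux, bT_eq_sing, symb_single, bracketQ, mon_mul_mon, hg, -Finsupp.smul_single]
    have h2 : ∀ g g', symb (tmul (sing (h, i)) (bracketAux (.Q, m) (h', j))) g g' =
        bracketQ m (mon 0 m) (symb (Finsupp.single ((h, i), (h', j)) 1) g) g' := by
      intro g g'
      by_cases hg : h = g <;> cases h' <;> cases g' <;>
        simp [bracketAux, bT_eq_sing, symb_single, bracketQ, mon_mul_mon, hg, -Finsupp.smul_single]
    have h3 : ∀ g, h ≠ g → symb (Finsupp.single ((h, i), (h', j)) 1) g = 0 := by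
      intro g hg
      ext1 g'
      simp [symb_single, hg]
    ext1 g
    ext1 g'
    simp only [actB, tmul2_eq_tmul, map_add, map_smul, Pi.add_apply, Pi.smul_apply, h1, h2, actQ]
    by_cases hg : h = g
    · subst hg
      cases h <;> rfl
    · rw [h3 g hg]
      cases g' <;> simp [bracketQ]

/-- All nonzero entries of `w` have total charge `c`. -/
def HasCharge (c : ℤ) (w : Symb) : Prop := ∀ g g', charge g + charge g' ≠ c → w g g' = 0

lemma hasCharge_sub {c : ℤ} {v w : Symb} (hv : HasCharge c v) (hw : HasCharge c w) :
    HasCharge c (v - w) := fun g g' h => by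
  rw [Pi.sub_apply, Pi.sub_apply, hv g g' h, hw g g' h, sub_zero]

lemma hasCharge_smul {c : ℤ} (b : Laurent) {w : Symb} (hw : HasCharge c w) :
    HasCharge c (b • w) := fun g g' h => by
  rw [Pi.smul_apply, Pi.smul_apply, hw g g' h, smul_zero]

lemma hasCharge_actL {c : ℤ} (n : ℤ) {w : Symb} (hw : HasCharge c w) :
    HasCharge c (actL n w) := fun g g' h => by
  rw [actL, hw g g' h, mul_zero, map_zero, sub_zero]

lemma mon_ne_zero (i j : ℤ) : mon i j ≠ 0 := by
  simp [mon]

/-- The element `x - y`. -/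
def diag : Laurent := mon 1 0 - mon 0 1

lemma diag_ne_zero : diag ≠ 0 := by
  rw [diag, sub_ne_zero, mon, mon, Ne, AddMonoidAlgebra.single_left_inj one_ne_zero]
  simp

lemma mon_two_zero : mon 2 0 = mon 1 0 ^ 2 := by rw [sq, mon_mul_mon]; rfl
lemma mon_zero_two : mon 0 2 = mon 0 1 ^ 2 := by rw [sq, mon_mul_mon]; rfl
lemma mon_three_zero : mon 3 0 = mon 1 0 ^ 3 := by rw [pow_succ, ← mon_two_zero, mon_mul_mon]; rfl
lemma mon_zero_three : mon 0 3 = mon 0 1 ^ 3 := by rw [pow_succ, ← mon_zero_two, mon_mul_mon]; rfl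

lemma eq_zero_of_diag_mul {b : Laurent} (hb : diag * b = 0) : b = 0 :=
  (mul_eq_zero.1 hb).resolve_left diag_ne_zero

lemma eq_zero_of_mon_mul {i j : ℤ} {b : Laurent} (hb : mon i j * b = 0) : b = 0 :=
  (mul_eq_zero.1 hb).resolve_left (mon_ne_zero i j)

lemma eq_zero_of_actQ {w : Symb} (hw : HasCharge 0 w) (h : ∀ m, actQ m w = 0) : w = 0 := by
  have h' := fun m g g' => congrFun₂ (h m) g g'
  simp only [actQ, Pi.zero_apply] at h'
  have h0 := h' 0 .L .Q
  have h1 := h' 1 .L .Q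
  have h2 := h' 2 .L .Q
  simp only [bracketQ, mon_two_zero, mon_zero_two, mon_zero] at h0 h1 h2
  simp [N2parity, psgn, two_smul] at h0 h1 h2
  have hLL : w .L .L = 0 := by
    refine eq_zero_of_diag_mul (eq_zero_of_mon_mul (i := 0) (j := 1) ?_)
    rw [diag]
    linear_combination -mon 1 0 * mon 0 1 * h0 + (mon 1 0 + mon 0 1) * h1 - h2
  have hLH : w .L .H = 0 := by
    refine eq_zero_of_diag_mul ?_
    rw [diag]
    linear_combination mon 1 0 * h0 - h1 + mon 0 1 * hLL
  have hGQ : w .G .Q = 0 := by simpa [hLH, ← two_smul ℂ] using h0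
  have hHH : w .H .H = 0 := by simpa [bracketQ, N2parity, psgn, hGQ, mon_zero] using h' 0 .H .Q
  have hHL : w .H .L = 0 := by
    simpa [bracketQ, N2parity, psgn, hGQ, hHH, mon_ne_zero] using h' 1 .H .Q
  have hQG : w .Q .G = 0 := by
    simpa [bracketQ, N2parity, psgn, hLL, hHL, mon_zero] using h' 0 .Q .L
  ext1 g
  ext1 g'
  cases g <;> cases g' <;> first | assumption | exact hw _ _ (by decide)

lemma eq_zero_of_actQ_one {w : Symb} (hw : HasCharge 1 w) (h : ∀ m, actQ m w = 0) : w = 0 := by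
  have h' := fun m g g' => congrFun₂ (h m) g g'
  simp only [actQ, Pi.zero_apply] at h'
  have hGH : w .G .H = 0 := by simpa [bracketQ, N2parity, psgn, mon_zero] using h' 0 .G .Q
  have hGL : w .G .L = 0 := by
    simpa [bracketQ, N2parity, psgn, hGH, mon_ne_zero] using h' 1 .G .Q
  have hHG : w .H .G = 0 := by simpa [bracketQ, N2parity, psgn, mon_zero] using h' 0 .Q .G
  have hLG : w .L .G = 0 := by
    simpa [bracketQ, N2parity, psgn, hHG, mon_ne_zero] using h' 1 .Q .G
  ext1 g
  ext1 g'
  cases g <;> cases g' <;> first | assumption | exact hw _ _ (by decide)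

lemma actQ_sub (m : ℤ) (v w : Symb) : actQ m (v - w) = actQ m v - actQ m w := by
  rw [eq_sub_iff_add_eq, ← actQ_add, sub_add_cancel]

lemma actQ_smul_complex (m : ℤ) (c : ℂ) (w : Symb) : actQ m (c • w) = c • actQ m w := by
  rw [smul_symb, actQ_smul, ← smul_symb]

/-- Commutation of the actions of `Q_m` and `L_n`. -/
lemma actQ_actL (m n : ℤ) (w : Symb) :
    actQ m (actL n w) = actL n (actQ m w) + (m : ℂ) • actQ (m + n) w := by
  rw [← symb_ofSymb w, ← symb_act_L, ← symb_act_Q, ← symb_act_Q, ← symb_act_Q, ← symb_act_L,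
    ← map_smul, ← map_add]
  congr 1
  have h := act_bracketAux (.Q, m) (.L, n) (ofSymb w)
  have hk : ksgn (.Q, m) (.L, n) = 1 := rfl
  rw [hk, one_smul] at h
  rw [eq_sub_iff_add_eq.1 h |>.symm]
  simp [bracketAux, bT_eq_sing, add_comm]

lemma euler_mon_mul (n i j : ℤ) (b : Laurent) : euler n (mon i j * b) =
    mon i j * euler n b + ((i : ℂ) • mon (i + n) j + (j : ℂ) • mon i (j + n)) * b := by
  induction b using laurent_induction with
  | h0 => simp
  | hadd a b ha hb => simp only [mul_add, map_add, ha, hb]; abel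
  | hs k l c =>
    simp only [euler, mul_smul_comm, map_smul, mon_mul_mon, monLift_mon, mul_add, add_mul,
      smul_mul_assoc, add_assoc, add_comm n, Int.cast_add, ← smul_add]
    congr 1
    module

/-- The Euler operator `x^i y^j ↦ j x^i y^j` in the second variable. -/
def eulerY : Laurent →ₗ[ℂ] Laurent := monLift fun i j => (j : ℂ) • mon i j

lemma euler_one (b : Laurent) : euler 1 b = mon 1 0 * euler 0 b - diag * eulerY b := by
  induction b using laurent_induction with
  | h0 => simp
  | hadd a b ha hb => simp only [mul_add, map_add, ha, hb]; abel
  | hs k l c =>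
    simp only [euler, eulerY, mul_smul_comm, map_smul, mon_mul_mon, monLift_mon, mul_add, sub_mul,
      diag, add_comm (1 : ℤ), add_zero, zero_add]
    module

lemma actL_diag_pow_smul {n : ℤ} {h : Laurent}
    (hn : mon (n + 1) 0 - mon 0 (n + 1) = diag * h) (k : ℕ) (w : Symb) :
    actL n (diag ^ k • w) = diag ^ k • (actL n w - (k : ℂ) • h • w) := by
  induction k generalizing w with
  | zero => simp
  | succ k ih =>
    have h1 : actL n (diag • w) = diag • (actL n w - h • w) := by
      ext1 g
      ext1 g'
      have h2 : euler n (diag * w g g') = diag * euler n (w g g') + diag * h * w g g' := by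
        rw [← hn]
        nth_rewrite 1 [diag]
        rw [sub_mul, map_sub, euler_mon_mul, euler_mon_mul]
        simp [diag, add_comm n]
        ring
      simp only [actL, Pi.smul_apply, Pi.sub_apply, smul_eq_mul, h2]
      ring
    rw [pow_succ, mul_smul, ih, h1, mul_smul]
    congr 1
    ext1 g
    ext1 g'
    simp only [Pi.smul_apply, Pi.sub_apply, smul_eq_mul]
    push_cast
    algebra

lemma diag_pow_smul_eq {DQ DL : ℤ → Symb} {k : ℕ} {w : Symb} {n : ℤ} {h : Laurent}
    (hn : mon (n + 1) 0 - mon 0 (n + 1) = diag * h)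
    (hQL : ∀ m n : ℤ, (m : ℂ) • DQ (m + n) = actQ m (DL n) - actL n (DQ m))
    (hDL : HasCharge 0 (DL n)) (hw : HasCharge 0 w) (hQ : ∀ m, diag ^ k • DQ m = actQ m w) :
    diag ^ k • DL n = actL n w + (k : ℂ) • h • w := by
  rw [← sub_eq_zero, ← sub_sub]
  refine eq_zero_of_actQ (hasCharge_sub (hasCharge_sub (hasCharge_smul _ hDL)
    (hasCharge_actL n hw)) ?_) fun m => ?_
  · rw [smul_symb]
    exact hasCharge_smul _ (hasCharge_smul _ hw)
  have h1 := congrArg (diag ^ k • ·) (hQL m n)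
  have h2 := actL_diag_pow_smul hn k (DQ m)
  simp only [smul_sub, smul_comm (diag ^ k) (m : ℂ), smul_comm (diag ^ k) (k : ℂ),
    smul_comm (diag ^ k) h, hQ] at h1 h2
  rw [actQ_sub, actQ_sub, actQ_actL, actQ_smul, actQ_smul_complex, actQ_smul]
  rw [h1, h2]
  abel

lemma wt_add_wt_add_ne_zero (g g' : N2Gen) (k : ℕ) : wt g + wt g' + (k + 1 : ℕ) ≠ 0 := by
  have : ∀ g, ∃ n : ℕ, wt g = n := fun g => by
    cases g
    exacts [⟨1, by simp [wt]⟩, ⟨0, by simp [wt]⟩, ⟨1, by simp [wt]⟩, ⟨0, by simp [wt]⟩]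
  obtain ⟨a, ha⟩ := this g
  obtain ⟨b, hb⟩ := this g'
  rw [ha, hb, ← Nat.cast_add, ← Nat.cast_add, Nat.cast_ne_zero]
  omega

/-- A power of `x - y` in the denominator of a potential for `Q ↦ D(Q)` can be lowered. -/
lemma exists_potential_of_succ {DQ DL : ℤ → Symb} {k : ℕ} {w : Symb}
    (hQL : ∀ m n : ℤ, (m : ℂ) • DQ (m + n) = actQ m (DL n) - actL n (DQ m))
    (hDL : ∀ n, HasCharge 0 (DL n)) (hw : HasCharge 0 w)
    (hQ : ∀ m, diag ^ (k + 1) • DQ m = actQ m w) :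
    ∃ w', HasCharge 0 w' ∧ ∀ m, diag ^ k • DQ m = actQ m w' := by
  have e0 := diag_pow_smul_eq (n := 0) (h := 1) (by simp [diag]) hQL (hDL 0) hw hQ
  have e1 := diag_pow_smul_eq (n := 1) (h := mon 1 0 + mon 0 1)
    (by simp only [one_add_one_eq_two, mon_two_zero, mon_zero_two, diag]; ring) hQL (hDL 1) hw hQ
  have hdvd : ∀ g g', ∃ f, w g g' = diag * f := by
    intro g g'
    have e0' := congrFun₂ e0 g g'
    have e1' := congrFun₂ e1 g g'
    simp only [Pi.smul_apply, Pi.add_apply, smul_eq_mul, actL, euler_one, one_mul, Int.cast_zero,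
      Int.cast_one, zero_mul, zero_smul, zero_add, zero_sub] at e0' e1'
    set f := w g g'
    set u0 := DL 0 g g'
    set u1 := DL 1 g g'
    have hy : mon 0 (-1) * mon 0 1 = 1 := by rw [mon_mul_mon]; rfl
    have hc := wt_add_wt_add_ne_zero g g' k
    set c := wt g + wt g' + (k + 1 : ℕ) with hcdef
    have key : c • (mon 0 1 * f) =
        diag * (diag ^ k * (u1 - mon 1 0 * u0) - eulerY f - wt g • f) := by
      have e2 : diag * (diag ^ k * (u1 - mon 1 0 * u0)) =
          diag ^ (k + 1) * u1 - mon 1 0 * (diag ^ (k + 1) * u0) := by ring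
      rw [mul_sub, mul_sub, e2, e0', e1', hcdef]
      generalize eulerY f = v, euler 0 f = v'
      simp only [diag, Algebra.smul_def, map_add]
      ring
    refine ⟨c⁻¹ • (mon 0 (-1) *
      (diag ^ k * (u1 - mon 1 0 * u0) - eulerY f - wt g • f)), ?_⟩
    rw [mul_smul_comm, mul_left_comm, ← key, mul_smul_comm, ← mul_assoc, hy, one_mul, smul_smul,
      inv_mul_cancel₀ hc, one_smul]
  choose f hf using hdvd
  refine ⟨f, fun g g' hg => eq_zero_of_diag_mul (by rw [← hf, hw g g' hg]), fun m => ?_⟩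
  have hwf : w = diag • f := by
    ext1 g
    ext1 g'
    exact hf g g'
  have h := hQ m
  rw [hwf, actQ_smul, pow_succ', mul_smul] at h
  ext1 g
  ext1 g'
  exact mul_left_cancel₀ diag_ne_zero (congrFun₂ h g g')

/-- Cramer's rule for vectors `δ` that are skew with respect to vectors `W`. -/
lemma exists_skew_matrix {ι κ R : Type*} [Fintype κ] [DecidableEq κ] [CommRing R] [IsDomain R]
    {W δ : ι → κ → R} (h : ∀ a b, W a ⬝ᵥ δ b + W b ⬝ᵥ δ a = 0) (p : κ → ι)
    (hdet : (Matrix.of fun j => W (p j)).det ≠ 0) :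
    ∃ Ω : Matrix κ κ R, Ω + Ω.transpose = 0 ∧
      ∀ a, (Matrix.of fun j => W (p j)).det • δ a = Matrix.vecMul (W a) Ω := by
  set M : Matrix κ κ R := Matrix.of fun j => W (p j) with hM
  set N : Matrix κ κ R := Matrix.of fun j => δ (p j) with hN
  have hMN : M * N.transpose + N * M.transpose = 0 := by
    ext i j
    simpa [Matrix.mul_apply, dotProduct, mul_comm, hM, hN] using h (p i) (p j)
  have hΩ : M * (M.adjugate * N) = M.det • N := by
    rw [← mul_assoc, Matrix.mul_adjugate, Matrix.smul_mul, Matrix.one_mul]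
  set Ω := M.adjugate * N with hΩdef
  have hskew : Ω + Ω.transpose = 0 := by
    have h1 : M * (Ω + Ω.transpose) * M.transpose = 0 := by
      rw [mul_add, add_mul, hΩ, mul_assoc M Ω.transpose, ← Matrix.transpose_mul, hΩ,
        Matrix.transpose_smul, Matrix.smul_mul, Matrix.mul_smul, ← smul_add, add_comm, hMN,
        smul_zero]
    have h2 : M * (Ω + Ω.transpose) = 0 := by
      have h3 := congrArg (· * M.transpose.adjugate) h1
      simpa [mul_assoc, Matrix.mul_adjugate, Matrix.det_transpose, hdet, -smul_add] using h3
    have h4 := congrArg (M.adjugate * ·) h2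
    simpa [← mul_assoc, Matrix.adjugate_mul, hdet, -smul_add] using h4
  refine ⟨Ω, hskew, fun a => ?_⟩
  rw [← sub_eq_zero]
  refine Matrix.eq_zero_of_mulVec_eq_zero hdet ?_
  ext j
  have h5 : Matrix.mulVec Ω (W (p j)) = -(M.det • δ (p j)) := by
    rw [eq_neg_of_add_eq_zero_left hskew, Matrix.neg_mulVec, Matrix.mulVec_transpose]
    congr 1
    exact congrFun hΩ j
  have h6 : M.mulVec (M.det • δ a - Matrix.vecMul (W a) Ω) j =
      M.det * (W (p j) ⬝ᵥ δ a) - W a ⬝ᵥ Matrix.mulVec Ω (W (p j)) := by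
    rw [Matrix.dotProduct_mulVec, Matrix.mulVec_sub, Matrix.mulVec_smul]
    simp [Matrix.mulVec, hM, dotProduct_comm]
  rw [h6, h5, dotProduct_neg, dotProduct_smul, smul_eq_mul, sub_neg_eq_add, ← mul_add, h,
    mul_zero, Pi.zero_apply]

/-- The coefficients of the linear form `w ↦ (Q_m · w)_{QQ}`. -/
def coeffQ (m : ℤ) : Fin 4 → Laurent :=
  ![mon m 0, (m : ℂ) • mon m 0, mon 0 m, (m : ℂ) • mon 0 m]

/-- The entries of charge `-1`, signed. -/
def entriesQ (w : Symb) : Fin 4 → Laurent := ![w .H .Q, w .L .Q, -w .Q .H, -w .Q .L]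

lemma actQ_Q_Q (m : ℤ) (w : Symb) : actQ m w .Q .Q = coeffQ m ⬝ᵥ entriesQ w := by
  simp [actQ, bracketQ, coeffQ, entriesQ, dotProduct, Fin.sum_univ_four, N2parity, psgn]
  ring

lemma det_coeffQ : (Matrix.of fun j : Fin 4 => coeffQ j).det = mon 1 1 * diag ^ 4 := by
  have h11 : mon 1 1 = mon 1 0 * mon 0 1 := by rw [mon_mul_mon]; rfl
  rw [Matrix.det_succ_row_zero]
  simp [Fin.sum_univ_succ, Matrix.det_fin_three, coeffQ, Fin.succAbove, mon_zero, h11,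
    mon_two_zero, mon_zero_two, mon_three_zero, mon_zero_three, Algebra.smul_def, diag]
  ring

/-- The entries of charge `0` encoded by a skew matrix. -/
def potential (Ω : Matrix (Fin 4) (Fin 4) Laurent) : Symb
  | .G, .Q => (2⁻¹ : ℂ) • Ω 0 1
  | .Q, .G => (2⁻¹ : ℂ) • Ω 2 3
  | .H, .H => Ω 2 0
  | .H, .L => Ω 3 0
  | .L, .H => Ω 2 1
  | .L, .L => Ω 3 1
  | _, _ => 0

lemma exists_potential_pow_four {DQ : ℤ → Symb} (hc : ∀ m, HasCharge (-1) (DQ m))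
    (hQQ : ∀ m n, actQ m (DQ n) + actQ n (DQ m) = 0) :
    ∃ w, HasCharge 0 w ∧ ∀ m, diag ^ 4 • DQ m = actQ m w := by
  obtain ⟨Ω, hΩ, h⟩ := exists_skew_matrix (W := coeffQ) (δ := fun m => entriesQ (DQ m))
    (fun a b => by
      rw [← actQ_Q_Q, ← actQ_Q_Q]
      exact congrFun₂ (hQQ a b) .Q .Q) (fun j : Fin 4 => (j : ℤ))
    (by rw [det_coeffQ]; exact mul_ne_zero (mon_ne_zero _ _) (pow_ne_zero _ diag_ne_zero))
  rw [det_coeffQ] at h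
  have hw : HasCharge 0 (potential Ω) := fun g g' hg => by
    cases g <;> cases g' <;> first | rfl | exact absurd rfl hg
  refine ⟨mon (-1) (-1) • potential Ω, hasCharge_smul _ hw, fun m => ?_⟩
  have hs : ∀ i j, Ω i j = -Ω j i := fun i j => eq_neg_of_add_eq_zero_left (congrFun₂ hΩ i j)
  have hd : ∀ i, Ω i i = 0 := fun i =>
    (smul_eq_zero.1 ((two_smul ℂ _).trans (congrFun₂ hΩ i i))).resolve_left two_ne_zero
  have key : (mon 1 1 * diag ^ 4) • DQ m = actQ m (potential Ω) := by
    have hm := h m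
    have k0 := congrFun hm 0
    have k1 := congrFun hm 1
    have k2 := congrFun hm 2
    have k3 := congrFun hm 3
    simp [entriesQ, coeffQ, Matrix.vecMul, dotProduct, Fin.sum_univ_four, hd, hs 1 0, hs 0 2,
      hs 0 3, hs 1 2, hs 1 3, hs 3 2] at k0 k1 k2 k3
    ext1 g
    ext1 g'
    simp only [Pi.smul_apply, smul_eq_mul]
    by_cases hg : charge g + charge g' = -1
    · cases g <;> cases g' <;> first | exact absurd hg (by decide) | skip
      · simp [k1, actQ, bracketQ, potential, N2parity, psgn]
        algebra
      · simp [k0, actQ, bracketQ, potential, N2parity, psgn]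
        algebra
      · rw [← neg_inj, ← mul_neg]
        simp [k3, actQ, bracketQ, potential, N2parity, psgn]
        algebra
      · rw [← neg_inj, ← mul_neg]
        simp [k2, actQ, bracketQ, potential, N2parity, psgn]
        algebra
    · rw [hc m g g' hg]
      cases g <;> cases g' <;> first | exact absurd rfl hg | skip
      all_goals simp [actQ, bracketQ, potential, N2parity, psgn]
  rw [actQ_smul, ← key, smul_smul, ← mul_assoc, mon_mul_mon]
  simp [mon_zero]

lemma symb_apply_eq_zero {v : TT} {g g' : N2Gen} (h : ∀ m n, v ((g, m), (g', n)) = 0) :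
    symb v g g' = 0 := by
  rw [← Finsupp.sum_single v, Finsupp.sum, map_sum, Finset.sum_apply, Finset.sum_apply]
  refine Finset.sum_eq_zero fun q _ => ?_
  rw [← mul_one (v q), ← smul_eq_mul, ← Finsupp.smul_single, map_smul, Pi.smul_apply,
    Pi.smul_apply, symb_single]
  split_ifs with hq
  · obtain ⟨⟨a, i⟩, ⟨b, j⟩⟩ := q
    obtain ⟨rfl, rfl⟩ := hq
    rw [h, zero_smul]
  · rw [smul_zero]

lemma PreservesCharge.hasCharge {d : TopN2 → TT} (hc : PreservesCharge d) (i : N2Idx) :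
    HasCharge (charge i.1) (symb (d (sing i))) := fun _ _ h =>
  symb_apply_eq_zero fun _ _ => by_contra fun hne => h (hc i _ hne)

lemma ofSymb_apply (w : Symb) (q : N2Idx × N2Idx) (h : w q.1.1 q.2.1 = 0) : ofSymb w q = 0 := by
  have key : ∀ (g g' : N2Gen) (b : Laurent), ¬(g = q.1.1 ∧ g' = q.2.1) →
      monLift (fun i j => Finsupp.single ((g, i), (g', j)) (1 : ℂ)) b q = 0 := by
    intro g g' b hg
    induction b using laurent_induction with
    | h0 => simp
    | hadd a b ha hb => rw [map_add, Finsupp.add_apply, ha, hb, add_zero]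
    | hs i j c =>
      rw [map_smul, monLift_mon, Finsupp.smul_apply, Finsupp.single_eq_of_ne', smul_zero]
      rintro rfl
      exact hg ⟨rfl, rfl⟩
  rw [ofSymb, Finsupp.finsetSum_apply]
  refine Finset.sum_eq_zero fun g _ => ?_
  rw [Finsupp.finsetSum_apply]
  refine Finset.sum_eq_zero fun g' _ => ?_
  by_cases hg : g = q.1.1 ∧ g' = q.2.1
  · rw [hg.1, hg.2, h, map_zero, Finsupp.zero_apply]
  · exact key g g' _ hg

lemma isParityTT_ofSymb {w : Symb} (hw : HasCharge 0 w) : IsParityTT false (ofSymb w) := by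
  intro q hq
  by_contra hne
  refine Finsupp.mem_support_iff.1 hq (ofSymb_apply w q (hw _ _ fun h => hne ?_))
  exact pparity_eq_of_charge (i := (.L, 0)) h

lemma symb_leibniz_Q {d : TopN2 → TT} (hd : IsHomogDer false d) (m : ℤ) (j : N2Idx) :
    symb (d (bracketAux (.Q, m) j)) = actQ m (symb (d (sing j))) -
      psgn (N2parity j) • symb (act (sing j) (d (sing (.Q, m)))) := by
  rw [leibniz_sing hd, map_sub, map_smul, map_smul, symb_act_Q]
  have h : N2parity (.Q, m) = true := rfl
  have h' : psgn false = 1 := rfl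
  simp [h, h']

/-- An even charge-preserving derivation that kills all `Q_m` is zero. -/
lemma eq_zero_of_Q_eq_zero {d : TopN2 → TT} (hd : IsHomogDer false d) (hc : PreservesCharge d)
    (hQ : ∀ m, d (sing (.Q, m)) = 0) (i : N2Idx) : d (sing i) = 0 := by
  have hsmul : ∀ (c : ℂ) x, d (c • x) = c • d x := hd.2.1
  have hl := fun m j => symb_leibniz_Q hd m j
  simp only [hQ, map_zero, smul_zero, sub_zero] at hl
  have hL : ∀ n, d (sing (.L, n)) = 0 := fun n => symb_injective <| by
    rw [map_zero]
    refine eq_zero_of_actQ (hc.hasCharge (.L, n)) fun m => ?_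
    rw [← hl, bracketAux, bT_eq_sing, hsmul, hQ, smul_zero, map_zero]
  have hH : ∀ n, d (sing (.H, n)) = 0 := fun n => symb_injective <| by
    rw [map_zero]
    refine eq_zero_of_actQ (hc.hasCharge (.H, n)) fun m => ?_
    rw [← hl, bracketAux, bT_eq_sing, hQ, map_zero]
  have hG : ∀ n, d (sing (.G, n)) = 0 := fun n => symb_injective <| by
    rw [map_zero]
    refine eq_zero_of_actQ_one (hc.hasCharge (.G, n)) fun m => ?_
    rw [← hl, bracketAux, bT_eq_sing, bT_eq_sing, hd.1, hsmul, hsmul, hL, hH, smul_zero,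
      smul_zero, add_zero, map_zero]
  obtain ⟨i, n⟩ := i
  cases i
  exacts [hL n, hH n, hG n, hQ n]

/-- Even charge-preserving derivations are inner. -/
lemma exists_eq_innerDer {d : TopN2 → TT} (hd : IsHomogDer false d) (hc : PreservesCharge d) :
    ∃ a, IsParityTT false a ∧ d = innerDer a := by
  set DQ : ℤ → Symb := fun m => symb (d (sing (.Q, m))) with hDQ
  set DL : ℤ → Symb := fun n => symb (d (sing (.L, n))) with hDL
  have hQQ : ∀ m n, actQ m (DQ n) + actQ n (DQ m) = 0 := fun m n => by
    have h := symb_leibniz_Q hd m (.Q, n)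
    rw [symb_act_Q, bracketAux, ← zero_smul ℂ (0 : TopN2), hd.2.1, zero_smul, map_zero] at h
    simpa [N2parity, psgn] using h.symm
    all_goals simp
  have hQL : ∀ m n : ℤ, (m : ℂ) • DQ (m + n) = actQ m (DL n) - actL n (DQ m) := fun m n => by
    have h := symb_leibniz_Q hd m (.L, n)
    rw [symb_act_L, bracketAux, bT_eq_sing, hd.2.1, map_smul] at h
    simpa [N2parity, psgn] using h
  have hpot : ∃ w, HasCharge 0 w ∧ ∀ m, diag ^ 0 • DQ m = actQ m w := by
    have hstep : ∀ k, (∃ w, HasCharge 0 w ∧ ∀ m, diag ^ (k + 1) • DQ m = actQ m w) →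
        ∃ w, HasCharge 0 w ∧ ∀ m, diag ^ k • DQ m = actQ m w := fun k ⟨w, hw, hQ⟩ =>
      exists_potential_of_succ hQL (fun n => hc.hasCharge (.L, n)) hw hQ
    exact hstep 0 (hstep 1 (hstep 2 (hstep 3
      (exists_potential_pow_four (fun m => hc.hasCharge (.Q, m)) hQQ))))
  obtain ⟨w, hw, hQ⟩ := hpot
  have ha := isParityTT_ofSymb hw
  refine ⟨ofSymb w, ha, eq_of_eq_on_sing hd (isHomogDer_innerDer ha) fun i => ?_⟩
  have hin : ∀ i, innerDer (ofSymb w) (sing i) = act (sing i) (ofSymb w) := fun i => by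
    rw [innerDer_eq_inner, inner_apply ha (isParityT_sing i)]
    simp [psgn]
  have hd' := isHomogDer_sub hd (isHomogDer_innerDer ha)
  have hQ' : ∀ m, (d - innerDer (ofSymb w)) (sing (.Q, m)) = 0 := fun m => by
    refine symb_injective ?_
    rw [Pi.sub_apply, map_sub, map_zero, hin, symb_act_Q, symb_ofSymb, ← hQ, pow_zero, one_smul,
      sub_self]
  refine sub_eq_zero.1 (eq_zero_of_Q_eq_zero hd' (preservesCharge_of_H_zero hd' ?_) hQ' i)
  have hH0 : ∀ v : TT, (∀ q, v q ≠ 0 → charge₂ q = 0) → act (sing (.H, 0)) v = 0 := fun v hv => by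
    ext q
    rw [act_H_zero]
    by_cases hq : v q = 0
    · simp [hq]
    · simp [hv q hq]
  rw [Pi.sub_apply, map_sub, hH0 _ (hc (.H, 0)), hin, hH0 (ofSymb w), map_zero, sub_zero]
  exact fun q hq => by_contra fun h => hq (ofSymb_apply w q (hw _ _ h))

end N2

end

/-- Every super-derivation from `T` to `V = T⊗T` (with the
adjoint diagonal action) is inner: `Der(T,V) = Inn(T,V)`, where `Der(T,V)` is
the span of the homogeneous derivations and `Inn(T,V)` the span of the inner
derivations `a_inn` of homogeneous elements `a ∈ V`.  (Equivalently,
`H¹(T,T⊗T) ≅ Der(T,V)/Inn(T,V) = 0`.) -/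
theorem der_eq_inn :
    Submodule.span ℂ {d : TopN2 → TT | ∃ p : Bool, IsHomogDer p d} =
      Submodule.span ℂ
        {d : TopN2 → TT | ∃ (a : TT) (p : Bool), IsParityTT p a ∧ d = innerDer a} := by
  refine le_antisymm (Submodule.span_le.2 ?_) (Submodule.span_le.2 ?_)
  · rintro d ⟨p, hd⟩
    obtain ⟨a, ha, hc⟩ := N2.exists_preservesCharge hd
    have hd' := N2.isHomogDer_sub hd (N2.isHomogDer_innerDer ha)
    rw [← sub_add_cancel d (innerDer a)]
    refine add_mem ?_ (Submodule.subset_span ⟨a, p, ha, rfl⟩)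
    cases p
    · obtain ⟨b, hb, h⟩ := N2.exists_eq_innerDer hd' hc
      exact h ▸ Submodule.subset_span ⟨b, false, hb, rfl⟩
    · rw [N2.eq_zero_of_odd hd' hc]
      exact zero_mem _
  · rintro d ⟨a, p, ha, rfl⟩
    exact Submodule.subset_span ⟨p, N2.isHomogDer_innerDer ha⟩
end

section
/- Let T be the centerless topological N=2 superconformal algebra, V = T⊗T with the adjoint diagonal action, and let d ∈ Der(T, V) be a homogeneous derivation of degree i ∈ ℤ, i ≠ 0 (i.e., d(T_j) ⊂ V_{i+j} for all j ∈ ℤ). Then d is the inner derivation u_inn associated to u = −(1/i)·d(L_0) ∈ V_i; in particular every homogeneous derivation of nonzero degree is inner. -/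
theorem bracketAux_L_zero (j : N2Idx) :
    bracketAux (N2Gen.L, 0) j = (-(j.2 : ℂ)) • sing j := by
  obtain ⟨g, n⟩ := j
  cases g <;> simp [bracketAux, bT, sing]

theorem brk_sing (i j : N2Idx) : brk (sing i) (sing j) = bracketAux i j := by
  simp [brk, sing]

theorem tmul2_smul_sing_left (c : ℂ) (i j : N2Idx) :
    tmul2 (c • sing i) (sing j) = c • Finsupp.single (i, j) 1 := by
  simp [tmul2, sing, -Finsupp.single_mul]

theorem tmul2_smul_sing_right (c : ℂ) (i j : N2Idx) :
    tmul2 (sing i) (c • sing j) = c • Finsupp.single (i, j) 1 := by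
  simp [tmul2, sing, -Finsupp.single_mul]

theorem actB_L_zero (q : N2Idx × N2Idx) :
    actB (N2Gen.L, 0) q = (-((q.1.2 + q.2.2 : ℤ) : ℂ)) • Finsupp.single q 1 := by
  have hsgn : ksgn (N2Gen.L, 0) q.1 = 1 := by simp [ksgn, N2parity, psgn]
  rw [actB, bracketAux_L_zero, bracketAux_L_zero, tmul2_smul_sing_left, tmul2_smul_sing_right,
    hsgn, one_smul, ← add_smul]
  congr 1
  push_cast
  ring

theorem adT2_sing (i : N2Idx) (v : TT) :
    adT2 (sing i) v = v.sum fun q c => c • actB i q := by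
  simp [adT2, sing]

/-- `L_0` acts on `V_n` as the scalar `-n`. -/
theorem adT2_L_zero {n : ℤ} {v : TT} (hv : IsDegTT n v) :
    adT2 (sing (N2Gen.L, 0)) v = (-(n : ℂ)) • v := by
  rw [adT2_sing]
  conv_rhs => rw [← Finsupp.sum_single v, Finsupp.smul_sum]
  refine Finsupp.sum_congr fun q hq => ?_
  rw [actB_L_zero, hv q hq]
  simp [mul_comm]

theorem adT2_sing_smul (i : N2Idx) (c : ℂ) (v : TT) :
    adT2 (sing i) (c • v) = c • adT2 (sing i) v := by
  rw [adT2_sing, adT2_sing, Finsupp.sum_smul_index (by simp), Finsupp.smul_sum]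
  simp only [mul_smul]

theorem innerDer_sing {p : Bool} {v : TT} (hv : IsParityTT p v) (i : N2Idx) :
    innerDer v (sing i) = psgn (p && N2parity i) • adT2 (sing i) v := by
  rw [adT2_sing, Finsupp.smul_sum, innerDer, sing, Finsupp.sum_single_index (by simp)]
  refine Finsupp.sum_congr fun q hq => ?_
  rw [hv q hq, one_mul, smul_smul, mul_comm]

theorem innerDer_eq_linearCombination (v : TT) (x : TopN2) :
    innerDer v x = Finsupp.linearCombination ℂ (fun i => innerDer v (sing i)) x := by
  rw [Finsupp.linearCombination_apply, innerDer]
  refine Finsupp.sum_congr fun i _ => ?_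
  rw [innerDer, sing, Finsupp.sum_single_index (by simp), Finsupp.smul_sum]
  refine Finsupp.sum_congr fun q _ => ?_
  rw [one_mul, smul_smul, mul_assoc]

theorem isParityT_sing (i : N2Idx) : IsParityT (N2parity i) (sing i) := by
  intro j hj
  rw [Finset.mem_singleton.1 (Finsupp.support_single_subset hj)]

theorem isDegT_sing (i : N2Idx) : IsDegT i.2 (sing i) := by
  intro j hj
  rw [Finset.mem_singleton.1 (Finsupp.support_single_subset hj)]

theorem IsParityTT.smul {p : Bool} {v : TT} (hv : IsParityTT p v) (c : ℂ) :
    IsParityTT p (c • v) := fun q hq => hv q (Finsupp.support_smul hq)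

theorem IsDegTT.smul {n : ℤ} {v : TT} (hv : IsDegTT n v) (c : ℂ) :
    IsDegTT n (c • v) := fun q hq => hv q (Finsupp.support_smul hq)

/-- If `d ∈ Der(T, T⊗T)` is a homogeneous derivation of
degree `i ≠ 0` (i.e. `d(T_j) ⊂ V_{i+j}` for all `j`), then `d` is the inner
derivation attached to `u = −(1/i)·d(L_0) ∈ V_i`; in particular every
homogeneous derivation of nonzero degree is inner. -/
theorem nonzero_degree_derivation_is_inner
    (p : Bool) (i : ℤ) (hi : i ≠ 0) (d : TopN2 → TT) (hd : IsHomogDer p d)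
    (hdeg : ∀ (j : ℤ) (x : TopN2), IsDegT j x → IsDegTT (i + j) (d x)) :
    IsDegTT i ((-(1 : ℂ) / (i : ℂ)) • d (bT N2Gen.L 0)) ∧
      d = innerDer ((-(1 : ℂ) / (i : ℂ)) • d (bT N2Gen.L 0)) := by
  obtain ⟨hadd, hsmul, hpar, hleib⟩ := hd
  have hi' : (i : ℂ) ≠ 0 := Int.cast_ne_zero.2 hi
  change IsDegTT i (_ • d (sing (N2Gen.L, 0))) ∧ d = innerDer (_ • d (sing (N2Gen.L, 0)))
  have hLdeg : IsDegTT i (d (sing (N2Gen.L, 0))) := by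
    simpa using hdeg 0 _ (isDegT_sing (N2Gen.L, 0))
  have hLpar : IsParityTT p (d (sing (N2Gen.L, 0))) := by
    simpa using hpar false _ (isParityT_sing (N2Gen.L, 0))
  refine ⟨hLdeg.smul _, ?_⟩
  have hbasis (j : N2Idx) :
      d (sing j) = innerDer ((-(1 : ℂ) / (i : ℂ)) • d (sing (N2Gen.L, 0))) (sing j) := by
    have h := hleib false (N2parity j) _ _ (isParityT_sing (N2Gen.L, 0)) (isParityT_sing j)
    rw [brk_sing, bracketAux_L_zero, hsmul, adT2_L_zero (hdeg j.2 _ (isDegT_sing j)),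
      Bool.and_false, Bool.xor_false, Bool.and_comm (N2parity j)] at h
    rw [innerDer_sing (hLpar.smul _), adT2_sing_smul, smul_comm]
    have h1 : (i : ℂ) • d (sing j)
        = -(psgn (p && N2parity j) • adT2 (sing j) (d (sing (N2Gen.L, 0)))) := by
      rw [show psgn false = 1 from rfl, one_smul] at h
      rw [eq_sub_iff_add_eq] at h
      rw [eq_neg_iff_add_eq_zero, ← sub_eq_zero.2 h]
      push_cast
      module
    rw [neg_div, neg_smul, ← smul_neg, ← h1, smul_smul, one_div, inv_mul_cancel₀ hi', one_smul]
  let D : TopN2 →ₗ[ℂ] TT := { toFun := d, map_add' := hadd, map_smul' := hsmul }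
  funext x
  rw [innerDer_eq_linearCombination]
  refine LinearMap.congr_fun (f := D) (Finsupp.lhom_ext' fun j => LinearMap.ext_ring ?_) x
  simpa [D, sing] using hbasis j
end
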